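/- In the Gibbs setting on ℝ^n, take F_1, …, F_d ∈ C_c^∞(ℝ^n), set X := (L F_1, …, L F_d), and let N be a standard Gaussian vector in ℝ^d. Then for every p ∈ [1,∞): W_p(X, N)^p ≤ E[|N|^p] · E[‖Id_d − M‖^p], where M is the random d×d matrix with entries M_{ij} = Γ[X_i, −F_j] = −∇(L F_i)·∇F_j and ‖·‖ is the Hilbert–Schmidt norm. Moreover, in the univariate case d = 1, TV(X, N) ≤ 2 E[|1 − Γ[X, −F_1]|]. -/

import Mathlib

open MeasureTheory ProbabilityTheory Real Filter
open scoped ENNReal NNReal BigOperators Topology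

noncomputable section

/-- Partial derivative `∂_i F` of a function on `ℝⁿ`. -/
def pd {n : ℕ} (i : Fin n) (F : (Fin n → ℝ) → ℝ) (x : Fin n → ℝ) : ℝ :=
  deriv (fun t => F (Function.update x i t)) (x i)

/-- Carré du champ `Γ[F,G] = ∇F · ∇G`. -/
def cdc {n : ℕ} (F G : (Fin n → ℝ) → ℝ) (x : Fin n → ℝ) : ℝ :=
  ∑ i, pd i F x * pd i G x

/-- The diffusive Markov generator `L F = ΔF − ∇W·∇F`. -/
def genL {n : ℕ} (W F : (Fin n → ℝ) → ℝ) (x : Fin n → ℝ) : ℝ :=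
  (∑ i, pd i (pd i F) x) - cdc W F x

/-- Normalizing constant `Z₀ = ∫ e^{-W}`. -/
def gibbsZ {n : ℕ} (W : (Fin n → ℝ) → ℝ) : ℝ :=
  ∫ x : Fin n → ℝ, Real.exp (-W x)

/-- The Gibbs probability measure `P = Z₀⁻¹ e^{-W(x)} dx` on `ℝⁿ`. -/
def gibbsP {n : ℕ} (W : (Fin n → ℝ) → ℝ) : Measure (Fin n → ℝ) :=
  volume.withDensity fun x => ENNReal.ofReal (Real.exp (-W x) / gibbsZ W)

/-- Standard Gaussian measure on `ℝ^d` (with the Euclidean norm). -/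
def stdGaussianE (d : ℕ) : Measure (EuclideanSpace ℝ (Fin d)) :=
  (Measure.pi fun _ : Fin d => gaussianReal 0 1).map (EuclideanSpace.equiv (Fin d) ℝ).symm

/-- `p`-Wasserstein distance between two laws. -/
def wassersteinDist {E : Type*} [MeasurableSpace E] [NormedAddCommGroup E]
    (p : ℝ) (μ ν : Measure E) : ℝ :=
  sInf {r | ∃ cpl : Measure (E × E), IsProbabilityMeasure cpl ∧
    cpl.map Prod.fst = μ ∧ cpl.map Prod.snd = ν ∧ r = (∫ z, ‖z.1 - z.2‖ ^ p ∂cpl) ^ (1 / p)}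

/-- Total variation distance between two laws on `ℝ`. -/
def tvDist (μ ν : Measure ℝ) : ℝ :=
  sSup {r | ∃ B : Set ℝ, MeasurableSet B ∧ r = (μ B).toReal - (ν B).toReal}

/-- Frobenius (Hilbert–Schmidt) norm of a matrix. -/
def frobeniusNorm {d : ℕ} (A : Matrix (Fin d) (Fin d) ℝ) : ℝ :=
  Real.sqrt (∑ i, ∑ j, A i j ^ 2)

/-- Operator norm of a matrix acting on Euclidean space. -/
def matOpNorm {d : ℕ} (A : Matrix (Fin d) (Fin d) ℝ) : ℝ :=
  ‖Matrix.toEuclideanCLM (𝕜 := ℝ) A‖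

/-- A smooth compactly supported function on `ℝⁿ`. -/
def IsCcInfty {n : ℕ} (F : (Fin n → ℝ) → ℝ) : Prop :=
  ContDiff ℝ (⊤ : ℕ∞) F ∧ HasCompactSupport F

/-! ### Partial couplings -/

section PartialCoupling

variable {E : Type*} [NormedAddCommGroup E] [MeasurableSpace E]

/-- `μ` and `ν` admit a coupling of all but mass `δ` of `μ`, with `L^p` cost at most `r`. -/
def PartialCoupling (p : ℝ≥0∞) (μ ν : Measure E) (δ r : ℝ≥0∞) : Prop :=
  ∃ σ : Measure (E × E), σ.fst ≤ μ ∧ σ.snd ≤ ν ∧ μ Set.univ ≤ σ Set.univ + δ ∧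
    eLpNorm (fun z => z.1 - z.2) p σ ≤ r

theorem PartialCoupling.mono {p : ℝ≥0∞} {μ ν : Measure E} {δ δ' r r' : ℝ≥0∞}
    (h : PartialCoupling p μ ν δ r) (hδ : δ ≤ δ') (hr : r ≤ r') :
    PartialCoupling p μ ν δ' r' := by
  obtain ⟨σ, h1, h2, h3, h4⟩ := h
  exact ⟨σ, h1, h2, h3.trans (by gcongr), h4.trans hr⟩

variable [BorelSpace E] [SecondCountableTopology E]

theorem PartialCoupling.trans [CompleteSpace E] {p : ℝ≥0∞} (hp : 1 ≤ p) {μ ν ρ : Measure E}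
    [IsFiniteMeasure μ] [IsFiniteMeasure ν] [IsFiniteMeasure ρ] {δ δ' r r' : ℝ≥0∞}
    (h : PartialCoupling p μ ν δ r) (h' : PartialCoupling p ν ρ δ' r') :
    PartialCoupling p μ ρ (δ + δ') (r + r') := by
  obtain ⟨σ, hσ1, hσ2, hσm, hσr⟩ := h
  obtain ⟨γ, hγ1, hγ2, hγm, hγr⟩ := h'
  have : PolishSpace E := by infer_instance
  have : StandardBorelSpace E := by infer_instance
  have hσfin : IsFiniteMeasure σ := by
    refine ⟨?_⟩
    rw [← Measure.fst_univ]
    exact (hσ1 _).trans_lt (measure_lt_top μ _)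
  have hγfin : IsFiniteMeasure γ := by
    refine ⟨?_⟩
    rw [← Measure.fst_univ]
    exact (hγ1 _).trans_lt (measure_lt_top ν _)
  set w : E → ℝ≥0∞ := fun y => min (γ.fst.rnDeriv ν y) 1 with hw
  have hwm : Measurable w := (Measure.measurable_rnDeriv _ _).min measurable_const
  have hw1 : ∀ y, w y ≤ 1 := fun y => min_le_right _ _
  have hwν : ν.withDensity w = γ.fst := by
    rw [← Measure.withDensity_rnDeriv_eq _ _ (Measure.absolutelyContinuous_of_le hγ1)]
    refine withDensity_congr_ae ?_
    filter_upwards [Measure.rnDeriv_le_one_of_le hγ1] with y hy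
    exact min_eq_left hy
  have hlost : ∫⁻ y, (1 - w y) ∂ν ≤ δ' := by
    have e1 : ∫⁻ y, w y ∂ν = γ Set.univ := by
      rw [← Measure.fst_univ, ← hwν, withDensity_apply _ MeasurableSet.univ,
        Measure.restrict_univ]
    have e2 : ∫⁻ y, (1 - w y) ∂ν = ν Set.univ - γ Set.univ := by
      rw [lintegral_sub hwm (by rw [e1]; exact measure_ne_top _ _)
        (Eventually.of_forall hw1), e1]
      simp
    rw [e2]
    exact tsub_le_iff_left.2 hγm
  set σ' : Measure (E × E) := σ.withDensity fun z => w z.2 with hσ'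
  have hσ'le : σ' ≤ σ := by
    rw [hσ']
    conv_rhs => rw [← withDensity_one (μ := σ)]
    exact withDensity_mono (Eventually.of_forall fun z => hw1 _)
  have hσ'fin : IsFiniteMeasure σ' := isFiniteMeasure_of_le σ hσ'le
  have hσ'm : σ Set.univ ≤ σ' Set.univ + δ' := by
    have e1 : σ' Set.univ = ∫⁻ z, w z.2 ∂σ := by
      rw [hσ', withDensity_apply _ MeasurableSet.univ, Measure.restrict_univ]
    have e2 : ∫⁻ z, (1 - w z.2) ∂σ ≤ δ' := by
      refine le_trans ?_ hlost
      rw [← lintegral_map (μ := σ) (f := fun y => 1 - w y) (measurable_const.sub hwm)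
        measurable_snd]
      exact lintegral_mono' hσ2 le_rfl
    calc σ Set.univ = ∫⁻ z, (w z.2 + (1 - w z.2)) ∂σ := by
          simp [add_tsub_cancel_of_le (hw1 _)]
      _ = σ' Set.univ + ∫⁻ z, (1 - w z.2) ∂σ := by
          rw [e1]; exact lintegral_add_left (hwm.comp measurable_snd) _
      _ ≤ _ := by gcongr
  have hσ'snd : σ'.snd ≤ γ.fst := by
    rw [← hwν]
    refine Measure.le_iff.2 fun s hs => ?_
    rw [Measure.snd_apply hs, hσ', withDensity_apply _ (measurable_snd hs),
      withDensity_apply _ hs, ← lintegral_indicator hs,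
      ← lintegral_indicator (measurable_snd hs)]
    calc ∫⁻ z, (Prod.snd ⁻¹' s).indicator (fun z : E × E => w z.2) z ∂σ
        = ∫⁻ z, s.indicator w z.2 ∂σ := rfl
      _ = ∫⁻ y, s.indicator w y ∂σ.snd :=
          (lintegral_map (hwm.indicator hs) measurable_snd).symm
      _ ≤ _ := lintegral_mono' hσ2 le_rfl
  set κ : Kernel E E := γ.condKernel with hκ
  set Θ : Measure ((E × E) × E) := σ' ⊗ₘ (κ.comap Prod.snd measurable_snd) with hΘ
  have hΘ1 : Θ.map Prod.fst = σ' := Measure.fst_compProd _ _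
  have hΘ2 : Θ.map (fun t => (t.1.2, t.2)) ≤ γ := by
    refine Measure.le_iff.2 fun s hs => ?_
    have hm : Measurable fun t : (E × E) × E => (t.1.2, t.2) := by fun_prop
    have hk : Measurable fun y => κ y (Prod.mk y ⁻¹' s) := Kernel.measurable_kernel_prodMk_left hs
    rw [Measure.map_apply hm hs, hΘ, Measure.compProd_apply (hm hs)]
    calc ∫⁻ z, (κ.comap Prod.snd measurable_snd) z
            (Prod.mk z ⁻¹' ((fun t : (E × E) × E => (t.1.2, t.2)) ⁻¹' s)) ∂σ'
        = ∫⁻ z, κ z.2 (Prod.mk z.2 ⁻¹' s) ∂σ' := rfl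
      _ = ∫⁻ y, κ y (Prod.mk y ⁻¹' s) ∂σ'.snd := (lintegral_map hk measurable_snd).symm
      _ ≤ ∫⁻ y, κ y (Prod.mk y ⁻¹' s) ∂γ.fst := lintegral_mono' hσ'snd le_rfl
      _ = (γ.fst ⊗ₘ κ) s := (Measure.compProd_apply hs).symm
      _ = γ s := by rw [hκ, γ.disintegrate]
  have hm : Measurable fun t : (E × E) × E => (t.1.1, t.2) := by fun_prop
  refine ⟨Θ.map fun t => (t.1.1, t.2), ?_, ?_, ?_, ?_⟩
  · have : (Θ.map fun t => (t.1.1, t.2)).fst = σ'.fst := by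
      rw [← hΘ1, Measure.fst, Measure.fst, Measure.map_map measurable_fst hm,
        Measure.map_map measurable_fst measurable_fst]
      rfl
    rw [this]
    exact (Measure.map_mono hσ'le measurable_fst).trans hσ1
  · have : (Θ.map fun t => (t.1.1, t.2)).snd = (Θ.map fun t => (t.1.2, t.2)).snd := by
      rw [Measure.snd, Measure.snd, Measure.map_map measurable_snd hm,
        Measure.map_map measurable_snd (by fun_prop)]
      rfl
    rw [this]
    exact (Measure.map_mono hΘ2 measurable_snd).trans hγ2
  · rw [Measure.map_apply hm MeasurableSet.univ, Set.preimage_univ, hΘ,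
      Measure.compProd_apply_univ]
    calc μ Set.univ ≤ σ Set.univ + δ := hσm
      _ ≤ σ' Set.univ + δ' + δ := by gcongr
      _ = _ := by rw [add_assoc, add_comm δ']
  · have hd : Measurable fun z : E × E => z.1 - z.2 := by fun_prop
    rw [eLpNorm_map_measure hd.aestronglyMeasurable hm.aemeasurable]
    have e1 : eLpNorm (fun t : (E × E) × E => t.1.1 - t.1.2) p Θ ≤ r := by
      refine le_trans ?_ hσr
      refine le_trans (le_of_eq ?_) (eLpNorm_mono_measure _ hσ'le)
      rw [← hΘ1, eLpNorm_map_measure hd.aestronglyMeasurable measurable_fst.aemeasurable]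
      rfl
    have e2 : eLpNorm (fun t : (E × E) × E => t.1.2 - t.2) p Θ ≤ r' := by
      refine le_trans ?_ hγr
      refine le_trans (le_of_eq ?_) (eLpNorm_mono_measure _ hΘ2)
      rw [eLpNorm_map_measure hd.aestronglyMeasurable (by fun_prop)]
      rfl
    calc _ = eLpNorm ((fun t : (E × E) × E => t.1.1 - t.1.2) + fun t => t.1.2 - t.2) p Θ := by
          congr 1; ext t; simp
      _ ≤ _ := eLpNorm_add_le (by fun_prop) (by fun_prop) hp
      _ ≤ _ := add_le_add e1 e2

theorem partialCoupling_map {Ω : Type*} [MeasurableSpace Ω] {Q : Measure Ω} {Y Z : Ω → E}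
    (hY : Measurable Y) (hZ : Measurable Z) (p : ℝ≥0∞) :
    PartialCoupling p (Q.map Y) (Q.map Z) 0 (eLpNorm (fun ω => Y ω - Z ω) p Q) := by
  refine ⟨Q.map fun ω => (Y ω, Z ω), ?_, ?_, ?_, ?_⟩
  · rw [Measure.fst_map_prodMk hZ]
  · rw [Measure.snd_map_prodMk hY]
  · rw [Measure.map_apply hY MeasurableSet.univ,
      Measure.map_apply (hY.prodMk hZ) MeasurableSet.univ]
    simp
  · rw [eLpNorm_map_measure (by fun_prop) (hY.prodMk hZ).aemeasurable]
    rfl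

theorem partialCoupling_of_measure_le_add {p : ℝ≥0∞} {μ ν : Measure E} [IsFiniteMeasure μ]
    [IsFiniteMeasure ν] {δ : ℝ≥0∞} (h : ∀ B, MeasurableSet B → μ B ≤ ν B + δ) :
    PartialCoupling p μ ν δ 0 := by
  obtain ⟨s, hs, hle, hge⟩ := exists_isHahnDecomposition μ ν
  have hdiag : Measurable fun y : E => (y, y) := by fun_prop
  have e1 : ((μ.restrict s + ν.restrict sᶜ).map fun y : E => (y, y)).fst
      = μ.restrict s + ν.restrict sᶜ := by
    rw [Measure.fst, Measure.map_map measurable_fst hdiag]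
    exact Measure.map_id
  have e2 : ((μ.restrict s + ν.restrict sᶜ).map fun y : E => (y, y)).snd
      = μ.restrict s + ν.restrict sᶜ := by
    rw [Measure.snd, Measure.map_map measurable_snd hdiag]
    exact Measure.map_id
  refine ⟨(μ.restrict s + ν.restrict sᶜ).map fun y => (y, y), ?_, ?_, ?_, ?_⟩
  · rw [e1]
    conv_rhs => rw [← Measure.restrict_add_restrict_compl (μ := μ) hs]
    gcongr
  · rw [e2]
    conv_rhs => rw [← Measure.restrict_add_restrict_compl (μ := ν) hs]
    gcongr
  · rw [Measure.map_apply hdiag MeasurableSet.univ, Set.preimage_univ,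
      ← measure_add_measure_compl hs]
    simp only [Measure.coe_add, Pi.add_apply, Measure.restrict_apply_univ]
    rw [add_assoc]
    gcongr
    exact h _ hs.compl
  · rw [eLpNorm_map_measure (by fun_prop) hdiag.aemeasurable]
    simp [Function.comp_def]

end PartialCoupling

section Wasserstein

variable {E : Type*} [NormedAddCommGroup E] [MeasurableSpace E] [BorelSpace E]
  [SecondCountableTopology E]

theorem wassersteinDist_rpow_le_of_coupling {p : ℝ} (hp : 1 ≤ p) {μ ν : Measure E}
    {cpl : Measure (E × E)} [IsProbabilityMeasure cpl] (h1 : cpl.fst = μ) (h2 : cpl.snd = ν)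
    {C : ℝ≥0∞} (hC : C ≠ ⊤) (hcost : ∫⁻ z, ‖z.1 - z.2‖ₑ ^ p ∂cpl ≤ C) :
    wassersteinDist p μ ν ^ p ≤ C.toReal := by
  have hp0 : p ≠ 0 := by positivity
  have hint : ∫ z, ‖z.1 - z.2‖ ^ p ∂cpl ≤ C.toReal := by
    rw [integral_eq_lintegral_of_nonneg_ae (Eventually.of_forall fun z => by positivity)
      (Measurable.aestronglyMeasurable (by fun_prop))]
    refine ENNReal.toReal_mono hC (le_trans (le_of_eq ?_) hcost)
    refine lintegral_congr fun z => ?_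
    rw [← ofReal_norm, ENNReal.ofReal_rpow_of_nonneg (norm_nonneg _) (by positivity)]
  have hint0 : 0 ≤ ∫ z, ‖z.1 - z.2‖ ^ p ∂cpl := integral_nonneg fun z => by positivity
  have hnn : ∀ r ∈ {r | ∃ cpl : Measure (E × E), IsProbabilityMeasure cpl ∧
      cpl.map Prod.fst = μ ∧ cpl.map Prod.snd = ν ∧
        r = (∫ z, ‖z.1 - z.2‖ ^ p ∂cpl) ^ (1 / p)}, (0 : ℝ) ≤ r := by
    rintro r ⟨c, -, -, -, rfl⟩
    have : 0 ≤ ∫ z, ‖z.1 - z.2‖ ^ p ∂c := integral_nonneg fun z => by positivity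
    positivity
  have hle : wassersteinDist p μ ν ≤ (∫ z, ‖z.1 - z.2‖ ^ p ∂cpl) ^ (1 / p) :=
    csInf_le ⟨0, fun r hr => hnn r hr⟩ ⟨cpl, inferInstance, h1, h2, rfl⟩
  calc wassersteinDist p μ ν ^ p ≤ ((∫ z, ‖z.1 - z.2‖ ^ p ∂cpl) ^ (1 / p)) ^ p :=
        Real.rpow_le_rpow (Real.sInf_nonneg hnn) hle (by positivity)
    _ = ∫ z, ‖z.1 - z.2‖ ^ p ∂cpl := by
        rw [← Real.rpow_mul hint0, one_div_mul_cancel hp0, Real.rpow_one]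
    _ ≤ _ := hint

theorem lintegral_le_of_le_of_measure_univ_le {Ω : Type*} [MeasurableSpace Ω] {α μ : Measure Ω}
    (hα : α ≤ μ) {t : ℝ≥0∞} (ht : t ≠ 0) (htop : t ≠ ⊤) (hαt : α Set.univ ≤ t ^ 2)
    (f : Ω → ℝ≥0∞) :
    ∫⁻ x, f x ∂α ≤ t * (∫⁻ x, f x ^ 2 ∂μ + 1) := by
  have key : ∀ a : ℝ≥0∞, a ≤ t * a ^ 2 + t⁻¹ := by
    intro a
    rcases le_total a t⁻¹ with h | h
    · exact h.trans le_add_self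
    · refine le_trans ?_ le_self_add
      have : 1 ≤ t * a := by
        rw [← ENNReal.mul_inv_cancel ht htop]; gcongr
      calc a = 1 * a := (one_mul a).symm
        _ ≤ t * a * a := by gcongr
        _ = _ := by ring
  calc ∫⁻ x, f x ∂α ≤ ∫⁻ x, (t * f x ^ 2 + t⁻¹) ∂α := lintegral_mono fun x => key _
    _ = t * ∫⁻ x, f x ^ 2 ∂α + t⁻¹ * α Set.univ := by
        rw [lintegral_add_right _ measurable_const, lintegral_const_mul' _ _ htop, lintegral_const]
    _ ≤ t * ∫⁻ x, f x ^ 2 ∂μ + t⁻¹ * t ^ 2 := by gcongr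
    _ = _ := by
        rw [mul_add, mul_one, sq, ← mul_assoc, ENNReal.inv_mul_cancel ht htop, one_mul]

theorem PartialCoupling.exists_coupling {p : ℝ} (hp : 1 ≤ p) {μ ν : Measure E}
    [IsProbabilityMeasure μ] [IsProbabilityMeasure ν] {t r : ℝ≥0∞} (ht : t ≠ 0) (htop : t ≠ ⊤)
    (h : PartialCoupling (ENNReal.ofReal p) μ ν (t ^ 2) r) :
    ∃ cpl : Measure (E × E), IsProbabilityMeasure cpl ∧ cpl.fst = μ ∧ cpl.snd = ν ∧
      ∫⁻ z, ‖z.1 - z.2‖ₑ ^ p ∂cpl ≤ r ^ p + 2 ^ (p - 1) *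
        (t * (∫⁻ x, (‖x‖ₑ ^ p) ^ 2 ∂μ + 1) + t * (∫⁻ x, (‖x‖ₑ ^ p) ^ 2 ∂ν + 1)) := by
  obtain ⟨σ, h1, h2, hm, hr⟩ := h
  have hσfin : IsFiniteMeasure σ := by
    refine ⟨?_⟩
    rw [← Measure.fst_univ]
    exact (h1 _).trans_lt (measure_lt_top μ _)
  have hσ : ∫⁻ z, ‖z.1 - z.2‖ₑ ^ p ∂σ ≤ r ^ p := by
    have hp0 : ENNReal.ofReal p ≠ 0 := by simp; linarith
    rw [eLpNorm_eq_lintegral_rpow_enorm_toReal hp0 ENNReal.ofReal_ne_top,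
      ENNReal.toReal_ofReal (by linarith)] at hr
    calc _ = ((∫⁻ z, ‖z.1 - z.2‖ₑ ^ p ∂σ) ^ (1 / p)) ^ p := by
          rw [← ENNReal.rpow_mul, one_div_mul_cancel (by positivity), ENNReal.rpow_one]
      _ ≤ _ := by gcongr
  set α := μ - σ.fst with hα
  set β := ν - σ.snd with hβ
  have hα1 : α + σ.fst = μ := Measure.sub_add_cancel_of_le h1
  have hβ1 : β + σ.snd = ν := Measure.sub_add_cancel_of_le h2
  have hαm : α Set.univ + σ Set.univ = 1 := by
    rw [← Measure.fst_univ, ← Measure.add_apply, hα1, measure_univ]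
  have hβm : β Set.univ + σ Set.univ = 1 := by
    rw [← Measure.snd_univ, ← Measure.add_apply, hβ1, measure_univ]
  have hαβ : β Set.univ = α Set.univ :=
    (ENNReal.add_left_inj (measure_ne_top σ _)).1 (hβm.trans hαm.symm)
  have hαle : α ≤ μ := Measure.sub_le
  have hβle : β ≤ ν := Measure.sub_le
  have hαfin : IsFiniteMeasure α := isFiniteMeasure_of_le μ hαle
  have hβfin : IsFiniteMeasure β := isFiniteMeasure_of_le ν hβle
  have hαt : α Set.univ ≤ t ^ 2 := by
    rw [measure_univ, ← hαm, add_comm] at hm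
    exact (ENNReal.add_le_add_iff_left (measure_ne_top σ _)).1 hm
  set s := α Set.univ with hs
  have hmass : ∀ γ : Measure E, γ Set.univ = s → (s⁻¹ * s) • γ = γ := by
    intro γ hγ
    by_cases h0 : s = 0
    · have : γ = 0 := by rw [← Measure.measure_univ_eq_zero, hγ, h0]
      simp [this]
    · rw [ENNReal.inv_mul_cancel h0 (measure_ne_top _ _), one_smul]
  have hs1 : s⁻¹ * s ≤ 1 := ENNReal.inv_mul_le_one s
  have hfst : (σ + s⁻¹ • α.prod β).fst = μ := by
    rw [Measure.fst_add, Measure.fst, Measure.fst, Measure.map_smul, ← Measure.fst,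
      Measure.map_fst_prod, hαβ, smul_smul, hmass α rfl, add_comm, hα1]
  have hsnd : (σ + s⁻¹ • α.prod β).snd = ν := by
    rw [Measure.snd_add, Measure.snd, Measure.snd, Measure.map_smul, ← Measure.snd,
      Measure.map_snd_prod, smul_smul, hmass β hαβ, add_comm, hβ1]
  refine ⟨σ + s⁻¹ • α.prod β, ⟨by rw [← Measure.fst_univ, hfst, measure_univ]⟩, hfst, hsnd, ?_⟩
  rw [lintegral_add_measure, lintegral_smul_measure]
  refine add_le_add hσ ?_
  have hprod : ∫⁻ z, ‖z.1 - z.2‖ₑ ^ p ∂α.prod β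
      ≤ s * (2 ^ (p - 1) * (∫⁻ x, ‖x‖ₑ ^ p ∂α + ∫⁻ y, ‖y‖ₑ ^ p ∂β)) := by
    have hmeas : Measurable fun x : E => ‖x‖ₑ ^ p := by fun_prop
    calc ∫⁻ z, ‖z.1 - z.2‖ₑ ^ p ∂α.prod β
        ≤ ∫⁻ z, 2 ^ (p - 1) * (‖z.1‖ₑ ^ p + ‖z.2‖ₑ ^ p) ∂α.prod β := by
          refine lintegral_mono fun z => ?_
          refine le_trans ?_ (ENNReal.rpow_add_le_mul_rpow_add_rpow _ _ hp)
          gcongr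
          exact enorm_sub_le
      _ = 2 ^ (p - 1) * (∫⁻ z, ‖z.1‖ₑ ^ p ∂α.prod β + ∫⁻ z, ‖z.2‖ₑ ^ p ∂α.prod β) := by
          rw [lintegral_const_mul _ (by fun_prop), lintegral_add_left (by fun_prop)]
      _ = 2 ^ (p - 1) * (∫⁻ x, ‖x‖ₑ ^ p ∂(α.prod β).fst
            + ∫⁻ y, ‖y‖ₑ ^ p ∂(α.prod β).snd) := by
          rw [Measure.fst, Measure.snd, lintegral_map hmeas measurable_fst,
            lintegral_map hmeas measurable_snd]
      _ = _ := by
          rw [Measure.fst, Measure.snd, Measure.map_fst_prod, Measure.map_snd_prod, lintegral_smul_measure, lintegral_smul_measure,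
            hαβ, smul_eq_mul, smul_eq_mul]
          ring
  calc s⁻¹ • ∫⁻ z, ‖z.1 - z.2‖ₑ ^ p ∂α.prod β
      ≤ s⁻¹ • (s * (2 ^ (p - 1) * (∫⁻ x, ‖x‖ₑ ^ p ∂α + ∫⁻ y, ‖y‖ₑ ^ p ∂β))) := by gcongr
    _ = s⁻¹ * s * (2 ^ (p - 1) * (∫⁻ x, ‖x‖ₑ ^ p ∂α + ∫⁻ y, ‖y‖ₑ ^ p ∂β)) := by
        rw [smul_eq_mul]; ring
    _ ≤ 1 * (2 ^ (p - 1) * (∫⁻ x, ‖x‖ₑ ^ p ∂α + ∫⁻ y, ‖y‖ₑ ^ p ∂β)) := by gcongr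
    _ ≤ _ := by
        rw [one_mul]
        gcongr
        · exact lintegral_le_of_le_of_measure_univ_le hαle ht htop hαt _
        · exact lintegral_le_of_le_of_measure_univ_le hβle ht htop (hαβ.trans_le hαt) _

theorem wassersteinDist_rpow_le_of_partialCoupling {p : ℝ} (hp : 1 ≤ p) {μ ν : Measure E}
    [IsProbabilityMeasure μ] [IsProbabilityMeasure ν]
    (hμ : ∫⁻ x, (‖x‖ₑ ^ p) ^ 2 ∂μ ≠ ⊤) (hν : ∫⁻ x, (‖x‖ₑ ^ p) ^ 2 ∂ν ≠ ⊤) {r : ℝ} (hr : 0 ≤ r)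
    (h : ∀ ε : ℝ, 0 < ε → PartialCoupling (ENNReal.ofReal p) μ ν (ENNReal.ofReal ε)
      (ENNReal.ofReal (r + ε))) :
    wassersteinDist p μ ν ^ p ≤ r ^ p := by
  set K := ∫⁻ x, (‖x‖ₑ ^ p) ^ 2 ∂μ
  set L := ∫⁻ x, (‖x‖ₑ ^ p) ^ 2 ∂ν
  have hlim : Tendsto (fun t : ℝ => (r + t) ^ p + 2 ^ (p - 1) *
      (t * (K.toReal + 1) + t * (L.toReal + 1))) (𝓝[>] 0) (𝓝 (r ^ p)) := by
    have hc : Continuous fun t : ℝ => (r + t) ^ p + 2 ^ (p - 1) *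
        (t * (K.toReal + 1) + t * (L.toReal + 1)) := by
      have : Continuous fun t : ℝ => (r + t) ^ p :=
        (continuous_const.add continuous_id).rpow_const fun _ => Or.inr (by linarith)
      fun_prop
    have := hc.tendsto 0
    simp only [add_zero, zero_mul, mul_zero] at this
    exact this.mono_left nhdsWithin_le_nhds
  refine ge_of_tendsto hlim ?_
  filter_upwards [Ioo_mem_nhdsGT (show (0 : ℝ) < 1 by norm_num)] with t ht
  have ht0 : 0 < t := ht.1
  have hsq : t ^ 2 ≤ t := by nlinarith [ht.2]
  have hpc : PartialCoupling (ENNReal.ofReal p) μ ν (ENNReal.ofReal t ^ 2)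
      (ENNReal.ofReal (r + t)) := by
    refine (h (t ^ 2) (by positivity)).mono ?_ ?_
    · rw [ENNReal.ofReal_pow ht0.le]
    · gcongr
  obtain ⟨cpl, hprob, h1, h2, hcost⟩ :=
    hpc.exists_coupling hp (by simpa using ht0) ENNReal.ofReal_ne_top
  have h2p : (2 : ℝ≥0∞) ^ (p - 1) ≠ ⊤ := ENNReal.rpow_ne_top_of_nonneg (by linarith) (by simp)
  have hrp : ENNReal.ofReal (r + t) ^ p ≠ ⊤ :=
    ENNReal.rpow_ne_top_of_nonneg (by linarith) ENNReal.ofReal_ne_top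
  have hK : ENNReal.ofReal t * (K + 1) ≠ ⊤ :=
    ENNReal.mul_ne_top ENNReal.ofReal_ne_top (by simp [hμ])
  have hL : ENNReal.ofReal t * (L + 1) ≠ ⊤ :=
    ENNReal.mul_ne_top ENNReal.ofReal_ne_top (by simp [hν])
  have hsum := ENNReal.mul_ne_top h2p (ENNReal.add_ne_top.2 ⟨hK, hL⟩)
  refine (wassersteinDist_rpow_le_of_coupling hp h1 h2 (ENNReal.add_ne_top.2 ⟨hrp, hsum⟩)
    hcost).trans (le_of_eq ?_)
  rw [ENNReal.toReal_add hrp hsum, ENNReal.toReal_mul, ENNReal.toReal_add hK hL,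
    ENNReal.toReal_mul, ENNReal.toReal_mul, ENNReal.toReal_add hμ (by simp),
    ENNReal.toReal_add hν (by simp), ← ENNReal.toReal_rpow, ← ENNReal.toReal_rpow,
    ENNReal.toReal_ofReal ht0.le, ENNReal.toReal_ofReal (by positivity)]
  simp

end Wasserstein

/-! ### Smoothing by a compactly supported bump -/

section Smoothing

variable {E : Type*} [NormedAddCommGroup E] [NormedSpace ℝ E]

/-- `φ` is `C²`, and `φ` and its first two derivatives are bounded by `C`. -/
structure HasC2Bound (C : ℝ) (φ : E → ℝ) : Prop where
  contDiff : ContDiff ℝ 2 φ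
  abs_le : ∀ x, |φ x| ≤ C
  fderiv_le : ∀ x, ‖fderiv ℝ φ x‖ ≤ C
  fderiv_fderiv_le : ∀ x, ‖fderiv ℝ (fderiv ℝ φ) x‖ ≤ C

namespace HasC2Bound

variable {C : ℝ} {φ : E → ℝ}

theorem nonneg (h : HasC2Bound C φ) : 0 ≤ C := (abs_nonneg _).trans (h.abs_le 0)

theorem continuous (h : HasC2Bound C φ) : Continuous φ := h.contDiff.continuous

theorem contDiff_fderiv (h : HasC2Bound C φ) : ContDiff ℝ 1 (fderiv ℝ φ) :=
  h.contDiff.fderiv_right (by norm_num)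

theorem continuous_fderiv (h : HasC2Bound C φ) : Continuous (fderiv ℝ φ) :=
  h.contDiff_fderiv.continuous

theorem abs_fderiv_apply_le (h : HasC2Bound C φ) (z v : E) : |fderiv ℝ φ z v| ≤ C * ‖v‖ :=
  ((fderiv ℝ φ z).le_opNorm v).trans (by gcongr; exact h.fderiv_le z)

theorem norm_fderiv_sub_le (h : HasC2Bound C φ) (x y : E) :
    ‖fderiv ℝ φ y - fderiv ℝ φ x‖ ≤ C * ‖y - x‖ :=
  convex_univ.norm_image_sub_le_of_norm_fderiv_le
    (fun x _ => (h.contDiff_fderiv.differentiable (by norm_num)) x)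
    (fun x _ => h.fderiv_fderiv_le x) (Set.mem_univ _) (Set.mem_univ _)

theorem abs_taylor_le (h : HasC2Bound C φ) (z v : E) :
    |φ (z + v) - φ z - fderiv ℝ φ z v| ≤ C * ‖v‖ ^ 2 := by
  have hb : ∀ x ∈ Metric.closedBall z ‖v‖, ‖fderiv ℝ φ x - fderiv ℝ φ z‖ ≤ C * ‖v‖ := by
    intro x hx
    refine (h.norm_fderiv_sub_le z x).trans ?_
    have := h.nonneg
    gcongr
    rwa [← dist_eq_norm]
  have := (convex_closedBall z ‖v‖).norm_image_sub_le_of_norm_fderiv_le' (𝕜 := ℝ)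
    (fun x _ => (h.contDiff.differentiable (by norm_num)) x) hb
    (x := z) (y := z + v) (by simp) (by simp)
  rw [add_sub_cancel_left] at this
  calc _ ≤ C * ‖v‖ * ‖v‖ := this
    _ = _ := by ring

end HasC2Bound

variable [FiniteDimensional ℝ E] [MeasurableSpace E] [BorelSpace E]

theorem norm_convolution_le {F G H : Type*} [NormedAddCommGroup F] [NormedSpace ℝ F]
    [NormedAddCommGroup G] [NormedSpace ℝ G] [NormedAddCommGroup H] [NormedSpace ℝ H]
    {μ : Measure E} [μ.IsAddHaarMeasure] (L : F →L[ℝ] G →L[ℝ] H) {f : E → F}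
    (hf : ∀ x, ‖f x‖ ≤ 1) {g : E → G} (hg : Integrable g μ) (x : E) :
    ‖convolution f g L μ x‖ ≤ ‖L‖ * ∫ y, ‖g y‖ ∂μ := by
  rw [convolution_def, ← integral_const_mul,
    ← integral_sub_left_eq_self (fun y => ‖L‖ * ‖g y‖) μ x]
  refine norm_integral_le_of_norm_le ((hg.norm.const_mul _).comp_sub_left x)
    (Eventually.of_forall fun t => ?_)
  calc ‖L (f t) (g (x - t))‖ ≤ ‖L‖ * ‖f t‖ * ‖g (x - t)‖ := L.le_opNorm₂ _ _
    _ ≤ ‖L‖ * 1 * ‖g (x - t)‖ := by gcongr; exact hf t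
    _ = _ := by rw [mul_one]

set_option maxSynthPendingDepth 3 in
theorem exists_hasC2Bound_convolution {μ : Measure E} [μ.IsAddHaarMeasure] {b : E → ℝ}
    (hb : ContDiff ℝ 2 b) (hbc : HasCompactSupport b) :
    ∃ C, ∀ f : E → ℝ, Measurable f → (∀ x, ‖f x‖ ≤ 1) →
      HasC2Bound C (convolution f b (ContinuousLinearMap.lsmul ℝ ℝ) μ) := by
  set L : ℝ →L[ℝ] ℝ →L[ℝ] ℝ := ContinuousLinearMap.lsmul ℝ ℝ with hL
  have hb1 : ContDiff ℝ 1 b := hb.of_le (by norm_num)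
  have hb' : ContDiff ℝ 1 (fderiv ℝ b) := hb.fderiv_right (by norm_num)
  have hbc' : HasCompactSupport (fderiv ℝ b) := hbc.fderiv ℝ
  have hi0 : Integrable b μ := hb.continuous.integrable_of_hasCompactSupport hbc
  have hi1 : Integrable (fderiv ℝ b) μ := hb'.continuous.integrable_of_hasCompactSupport hbc'
  have hi2 : Integrable (fderiv ℝ (fderiv ℝ b)) μ :=
    (hb'.continuous_fderiv (by norm_num)).integrable_of_hasCompactSupport (hbc'.fderiv ℝ)
  set C0 := ‖L‖ * ∫ y, ‖b y‖ ∂μ with hC0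
  set C1 := ‖L.precompR E‖ * ∫ y, ‖fderiv ℝ b y‖ ∂μ with hC1
  set C2 := ‖(L.precompR E).precompR E‖ * ∫ y, ‖fderiv ℝ (fderiv ℝ b) y‖ ∂μ with hC2
  refine ⟨max C0 (max C1 C2), fun f hfm hf => ?_⟩
  have hfl : LocallyIntegrable f μ := by
    refine (locallyIntegrable_const (1 : ℝ)).mono hfm.aestronglyMeasurable
      (Eventually.of_forall fun x => ?_)
    simpa using hf x
  have hd1 : fderiv ℝ (convolution f b L μ) = convolution f (fderiv ℝ b) (L.precompR E) μ :=
    funext fun x => (hbc.hasFDerivAt_convolution_right L hfl hb1 x).fderiv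
  have hd2 : fderiv ℝ (fderiv ℝ (convolution f b L μ)) =
      convolution f (fderiv ℝ (fderiv ℝ b)) ((L.precompR E).precompR E) μ := by
    rw [hd1]
    exact funext fun x => (hbc'.hasFDerivAt_convolution_right _ hfl hb' x).fderiv
  refine ⟨hbc.contDiff_convolution_right (n := 2) L hfl hb, fun x => ?_, fun x => ?_, fun x => ?_⟩
  · exact (norm_convolution_le L hf hi0 x).trans (le_max_left _ _)
  · rw [hd1]
    exact (norm_convolution_le _ hf hi1 x).trans ((le_max_left _ _).trans (le_max_right _ _))
  · rw [hd2]
    exact (norm_convolution_le _ hf hi2 x).trans ((le_max_right _ _).trans (le_max_right _ _))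

theorem exists_smoothing_measure [HasContDiffBump E] (μ : Measure E) [μ.IsAddHaarMeasure] {η : ℝ}
    (hη : 0 < η) :
    ∃ ρ : Measure E, IsProbabilityMeasure ρ ∧ (∀ᵐ u ∂ρ, ‖u‖ ≤ η) ∧
      ∃ C, ∀ B : Set E, MeasurableSet B → HasC2Bound C fun z => ρ.real {u | z + u ∈ B} := by
  let f : ContDiffBump (0 : E) := ⟨η / 2, η, by positivity, by linarith⟩
  set b := f.normed μ with hb
  have hbm : Measurable fun x => ENNReal.ofReal (b x) :=
    f.continuous_normed.measurable.ennreal_ofReal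
  obtain ⟨C, hC⟩ := exists_hasC2Bound_convolution (μ := μ) (b := b)
    (f.contDiff_normed (n := 2)) f.hasCompactSupport_normed
  set ρ := μ.withDensity fun x => ENNReal.ofReal (b x) with hρ
  have hprob : IsProbabilityMeasure ρ := by
    refine ⟨?_⟩
    rw [hρ, withDensity_apply _ MeasurableSet.univ, Measure.restrict_univ,
      ← ofReal_integral_eq_lintegral_ofReal f.integrable_normed
        (Eventually.of_forall f.nonneg_normed), f.integral_normed, ENNReal.ofReal_one]
  refine ⟨ρ, hprob, ?_, C, fun B hB => ?_⟩
  · rw [hρ, ae_withDensity_iff hbm]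
    refine Eventually.of_forall fun u hu => ?_
    have : u ∈ Function.support b := by
      intro h0
      simp [h0] at hu
    rw [hb, f.support_normed_eq] at this
    simpa using (Metric.mem_ball.1 this).le
  · have hind : Measurable (B.indicator fun _ => (1 : ℝ)) := measurable_const.indicator hB
    have := hC (B.indicator fun _ => (1 : ℝ)) hind (fun x => by
      by_cases hx : x ∈ B <;> simp [hx])
    convert this using 1
    ext z
    have hset : MeasurableSet {u | z + u ∈ B} := measurable_const_add z hB
    rw [← integral_indicator_one hset, hρ, integral_withDensity_eq_integral_toReal_smul hbm
      (by simp), convolution_def,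
      ← integral_add_left_eq_self (fun t => ContinuousLinearMap.lsmul ℝ ℝ
        (B.indicator (fun _ => (1 : ℝ)) t) (b (z - t))) z]
    refine integral_congr_ae (Eventually.of_forall fun u => ?_)
    simp only [ContinuousLinearMap.lsmul_apply, smul_eq_mul]
    rw [ENNReal.toReal_ofReal (f.nonneg_normed u), sub_add_cancel_left, hb, f.normed_neg, mul_comm]
    rfl

end Smoothing

/-! ### Wasserstein bound along the circular interpolation -/

section Interpolation

variable {Ω E : Type*} [MeasurableSpace Ω] [NormedAddCommGroup E] [InnerProductSpace ℝ E]
  {Q : Measure Ω}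

namespace HasC2Bound

variable {C : ℝ} {φ : E → ℝ}

theorem abs_integral_fderiv_apply_le (h : HasC2Bound C φ) {Z v : Ω → E} (hv : Integrable v Q) :
    |∫ ω, fderiv ℝ φ (Z ω) (v ω) ∂Q| ≤ C * ∫ ω, ‖v ω‖ ∂Q := by
  rw [← integral_const_mul, ← Real.norm_eq_abs]
  exact norm_integral_le_of_norm_le (hv.norm.const_mul C)
    (Eventually.of_forall fun ω => h.abs_fderiv_apply_le _ _)

variable [MeasurableSpace E] [BorelSpace E]

theorem integrable_comp [IsProbabilityMeasure Q] (h : HasC2Bound C φ) {Z : Ω → E}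
    (hZ : Measurable Z) :
    Integrable (fun ω => φ (Z ω)) Q :=
  Integrable.of_bound (h.continuous.measurable.comp hZ).aestronglyMeasurable C
    (Eventually.of_forall fun _ => h.abs_le _)

theorem integrable_fderiv_apply [SecondCountableTopology E] (h : HasC2Bound C φ)
    {Z v : Ω → E} (hZ : Measurable Z) (hvm : Measurable v) (hv : Integrable v Q) :
    Integrable (fun ω => fderiv ℝ φ (Z ω) (v ω)) Q := by
  refine (hv.norm.const_mul C).mono' ?_ (Eventually.of_forall fun ω => h.abs_fderiv_apply_le _ _)
  have hc : Continuous fun q : E × E => fderiv ℝ φ q.1 q.2 :=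
    (h.continuous_fderiv.comp continuous_fst).clm_apply continuous_snd
  exact (hc.measurable.comp (hZ.prodMk hvm)).aestronglyMeasurable

variable [SecondCountableTopology E] [IsProbabilityMeasure Q]

theorem abs_integral_taylor_le (h : HasC2Bound C φ) {Z v : Ω → E} (hZ : Measurable Z)
    (hvm : Measurable v) (hv : MemLp v 2 Q) :
    |∫ ω, φ (Z ω + v ω) ∂Q - ∫ ω, φ (Z ω) ∂Q - ∫ ω, fderiv ℝ φ (Z ω) (v ω) ∂Q|
      ≤ C * ∫ ω, ‖v ω‖ ^ 2 ∂Q := by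
  have hi1 := h.integrable_comp (Q := Q) (hZ.add hvm)
  have hi2 := h.integrable_comp (Q := Q) hZ
  have hi3 := h.integrable_fderiv_apply hZ hvm (hv.integrable (by norm_num))
  simp only [Pi.add_apply] at hi1
  have hi12 : Integrable (fun ω => φ (Z ω + v ω) - φ (Z ω)) Q := hi1.sub hi2
  rw [← integral_sub hi1 hi2, ← integral_sub hi12 hi3, ← integral_const_mul, ← Real.norm_eq_abs]
  have hsq : Integrable (fun ω => ‖v ω‖ ^ 2) Q := hv.integrable_norm_pow (by norm_num)
  exact norm_integral_le_of_norm_le (hsq.const_mul C)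
    (Eventually.of_forall fun ω => h.abs_taylor_le _ _)

end HasC2Bound

variable [MeasurableSpace E] [BorelSpace E] [SecondCountableTopology E] [IsProbabilityMeasure Q]

theorem abs_cos_add_sub_cos_le (θ : ℝ) {h : ℝ} (hh : 0 ≤ h) : |cos (θ + h) - cos θ| ≤ h := by
  have := Real.abs_cos_sub_cos_le (θ + h) θ
  rwa [add_sub_cancel_left, abs_of_nonneg hh] at this

theorem abs_sin_add_sub_sin_le (θ : ℝ) {h : ℝ} (hh : 0 ≤ h) : |sin (θ + h) - sin θ| ≤ h := by
  have := Real.abs_sin_sub_sin_le (θ + h) θ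
  rwa [add_sub_cancel_left, abs_of_nonneg hh] at this

/-- The velocity `V` generates the same first-order evolution of the laws of
`cos θ • X + sin θ • N` as the velocity `-sin θ • X + cos θ • N` of this path. -/
def IsSteinVelocity (Q : Measure Ω) (X N V : Ω → E) : Prop :=
  ∀ (C : ℝ) (φ : E → ℝ) (θ : ℝ), HasC2Bound C φ →
    ∫ ω, fderiv ℝ φ (cos θ • X ω + sin θ • N ω) (cos θ • V ω) ∂Q =
      ∫ ω, fderiv ℝ φ (cos θ • X ω + sin θ • N ω) (-sin θ • X ω + cos θ • N ω) ∂Q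

variable {X N V : Ω → E}

theorem IsSteinVelocity.abs_integral_sub_le (hV : IsSteinVelocity Q X N V) (hXm : Measurable X)
    (hNm : Measurable N) (hVm : Measurable V) (hX2 : MemLp X 2 Q) (hN2 : MemLp N 2 Q)
    (hV2 : MemLp V 2 Q) {C : ℝ} {φ : E → ℝ} (hφ : HasC2Bound C φ) (θ : ℝ) {h : ℝ} (hh : 0 ≤ h) :
    |∫ ω, φ (cos θ • X ω + sin θ • N ω + (sin h * cos θ) • V ω) ∂Q
      - ∫ ω, φ (cos (θ + h) • X ω + sin (θ + h) • N ω) ∂Q| ≤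
      C * (∫ ω, ‖V ω‖ ^ 2 ∂Q + ∫ ω, 2 * (‖X ω‖ ^ 2 + ‖N ω‖ ^ 2) ∂Q
        + ∫ ω, (‖X ω‖ + ‖N ω‖) ∂Q) * h ^ 2 := by
  set Z : Ω → E := fun ω => cos θ • X ω + sin θ • N ω with hZ
  have hC := hφ.nonneg
  have hXi : Integrable X Q := hX2.integrable (by norm_num)
  have hNi : Integrable N Q := hN2.integrable (by norm_num)
  have hZm : Measurable Z := by fun_prop
  have hZi : Integrable Z Q := (hXi.smul (cos θ)).add (hNi.smul (sin θ))
  have hsin : |sin h| ≤ h := (Real.abs_sin_le_abs).trans (abs_of_nonneg hh).le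
  have hcos0 : 0 ≤ 1 - cos h := sub_nonneg.2 (Real.cos_le_one h)
  have hcos1 : 1 - cos h ≤ h ^ 2 := by
    nlinarith [Real.one_sub_sq_div_two_le_cos (x := h), sq_nonneg h]
  set v : Ω → E := fun ω => (sin h * cos θ) • V ω with hv
  set w : Ω → E := fun ω => (cos (θ + h) - cos θ) • X ω + (sin (θ + h) - sin θ) • N ω with hw
  have hvm : Measurable v := by fun_prop
  have hwm : Measurable w := by fun_prop
  have hv2 : MemLp v 2 Q := hV2.const_smul _
  have hw2 : MemLp w 2 Q := (hX2.const_smul _).add (hN2.const_smul _)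
  have hw1 : ∀ ω, ‖w ω‖ ≤ h * (‖X ω‖ + ‖N ω‖) := by
    intro ω
    refine (norm_add_le _ _).trans ?_
    rw [norm_smul, norm_smul, mul_add]
    gcongr
    · exact abs_cos_add_sub_cos_le θ hh
    · exact abs_sin_add_sub_sin_le θ hh
  have e1 : ∀ ω, cos (θ + h) • X ω + sin (θ + h) • N ω = Z ω + w ω := by
    intro ω; simp only [hZ, hw]; module
  have hY : Integrable (fun ω => -sin θ • X ω + cos θ • N ω) Q :=
    (hXi.smul (-sin θ)).add (hNi.smul (cos θ))
  have e2 : ∫ ω, fderiv ℝ φ (Z ω) (w ω) ∂Q =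
      sin h * ∫ ω, fderiv ℝ φ (Z ω) (-sin θ • X ω + cos θ • N ω) ∂Q
        - (1 - cos h) * ∫ ω, fderiv ℝ φ (Z ω) (Z ω) ∂Q := by
    rw [← integral_const_mul, ← integral_const_mul, ← integral_sub
      ((hφ.integrable_fderiv_apply hZm (by fun_prop) hY).const_mul _)
      ((hφ.integrable_fderiv_apply hZm hZm hZi).const_mul _)]
    refine integral_congr_ae (Eventually.of_forall fun ω => ?_)
    simp only [← smul_eq_mul, ← map_smul, ← map_sub]
    congr 1
    simp only [hZ, hw, Real.cos_add, Real.sin_add]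
    module
  have e3 : ∫ ω, fderiv ℝ φ (Z ω) (v ω) ∂Q =
      sin h * ∫ ω, fderiv ℝ φ (Z ω) (-sin θ • X ω + cos θ • N ω) ∂Q := by
    rw [← hV C φ θ hφ, ← integral_const_mul]
    refine integral_congr_ae (Eventually.of_forall fun ω => ?_)
    simp only [hv, map_smul, smul_eq_mul]
    ring
  have t1 := hφ.abs_integral_taylor_le hZm hvm hv2
  have t2 := hφ.abs_integral_taylor_le hZm hwm hw2
  have t3 := hφ.abs_integral_fderiv_apply_le (Z := Z) hZi
  have hVsq : Integrable (fun ω => ‖V ω‖ ^ 2) Q := hV2.integrable_norm_pow (by norm_num)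
  have hXsq : Integrable (fun ω => ‖X ω‖ ^ 2) Q := hX2.integrable_norm_pow (by norm_num)
  have hNsq : Integrable (fun ω => ‖N ω‖ ^ 2) Q := hN2.integrable_norm_pow (by norm_num)
  have b1 : ∫ ω, ‖v ω‖ ^ 2 ∂Q ≤ h ^ 2 * ∫ ω, ‖V ω‖ ^ 2 ∂Q := by
    rw [← integral_const_mul]
    refine integral_mono (hv2.integrable_norm_pow (by norm_num)) (hVsq.const_mul _) fun ω => ?_
    rw [hv, norm_smul, mul_pow]
    gcongr
    rw [norm_mul]
    calc ‖sin h‖ * ‖cos θ‖ ≤ h * 1 := by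
          gcongr
          · exact hsin
          · exact Real.abs_cos_le_one θ
      _ = h := mul_one h
  have b2 : ∫ ω, ‖w ω‖ ^ 2 ∂Q ≤ h ^ 2 * ∫ ω, 2 * (‖X ω‖ ^ 2 + ‖N ω‖ ^ 2) ∂Q := by
    rw [← integral_const_mul]
    refine integral_mono (hw2.integrable_norm_pow (by norm_num))
      (((hXsq.add hNsq).const_mul _).const_mul _) fun ω => ?_
    calc ‖w ω‖ ^ 2 ≤ (h * (‖X ω‖ + ‖N ω‖)) ^ 2 := by gcongr; exact hw1 ω
      _ = h ^ 2 * (‖X ω‖ + ‖N ω‖) ^ 2 := by ring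
      _ ≤ _ := by gcongr; exact add_sq_le
  have b3 : ∫ ω, ‖Z ω‖ ∂Q ≤ ∫ ω, (‖X ω‖ + ‖N ω‖) ∂Q := by
    refine integral_mono hZi.norm (hXi.norm.add hNi.norm) fun ω => ?_
    refine (norm_add_le _ _).trans ?_
    rw [norm_smul, norm_smul]
    have h1 := Real.abs_cos_le_one θ
    have h2 := Real.abs_sin_le_one θ
    exact add_le_add (mul_le_of_le_one_left (norm_nonneg _) h1)
      (mul_le_of_le_one_left (norm_nonneg _) h2)
  simp only [e1]
  change |∫ ω, φ (Z ω + v ω) ∂Q - ∫ ω, φ (Z ω + w ω) ∂Q| ≤ _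
  rw [e2] at t2
  rw [e3] at t1
  have c1 := mul_le_mul_of_nonneg_left b1 hC
  have c2 := mul_le_mul_of_nonneg_left b2 hC
  have c3 : (1 - cos h) * |∫ ω, fderiv ℝ φ (Z ω) (Z ω) ∂Q|
      ≤ h ^ 2 * (C * ∫ ω, (‖X ω‖ + ‖N ω‖) ∂Q) := by
    gcongr
    exact t3.trans (by gcongr)
  have c4 : |(1 - cos h) * ∫ ω, fderiv ℝ φ (Z ω) (Z ω) ∂Q|
      = (1 - cos h) * |∫ ω, fderiv ℝ φ (Z ω) (Z ω) ∂Q| := by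
    rw [abs_mul, abs_of_nonneg hcos0]
  rw [abs_le] at t1 t2 ⊢
  have c5 := abs_le.1 (c4.trans_le c3)
  constructor <;> nlinarith [t1.1, t1.2, t2.1, t2.2, c5.1, c5.2]

end Interpolation

/-! ### Chaining the steps of the interpolation -/

section Chaining

variable {Ω E : Type*} [MeasurableSpace Ω] [NormedAddCommGroup E]
  [MeasurableSpace E] [BorelSpace E] [SecondCountableTopology E]
  {Q : Measure Ω} [IsProbabilityMeasure Q]

theorem map_add_prod_apply {ρ : Measure E} [IsProbabilityMeasure ρ] {Z : Ω → E}
    (hZ : Measurable Z) {B : Set E} (hB : MeasurableSet B) :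
    (Q.prod ρ).map (fun q => Z q.1 + q.2) B =
      ENNReal.ofReal (∫ ω, ρ.real {u | Z ω + u ∈ B} ∂Q) := by
  have hm : Measurable fun q : Ω × E => Z q.1 + q.2 := by fun_prop
  have hm' : Measurable fun ω => ρ {u | Z ω + u ∈ B} := measurable_measure_prodMk_left (hm hB)
  rw [Measure.map_apply hm hB, Measure.prod_apply (hm hB)]
  simp only [measureReal_def]
  rw [integral_toReal hm'.aemeasurable (Eventually.of_forall fun _ => measure_lt_top _ _),
    ENNReal.ofReal_toReal]
  · rfl
  · refine ne_top_of_le_ne_top ENNReal.one_ne_top ?_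
    calc ∫⁻ ω, ρ {u | Z ω + u ∈ B} ∂Q ≤ ∫⁻ _, 1 ∂Q := lintegral_mono fun _ => prob_le_one
      _ = 1 := by simp

variable {X N V : Ω → E}

theorem partialCoupling_map_add_prod {p : ℝ≥0∞} {ρ : Measure E} [IsProbabilityMeasure ρ] {η : ℝ}
    (hη : ∀ᵐ u ∂ρ, ‖u‖ ≤ η) (hXm : Measurable X) :
    PartialCoupling p (Q.map X) ((Q.prod ρ).map fun q => X q.1 + q.2) 0 (ENNReal.ofReal η) ∧
      PartialCoupling p ((Q.prod ρ).map fun q => X q.1 + q.2) (Q.map X) 0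
        (ENNReal.ofReal η) := by
  have hmap : Q.map X = (Q.prod ρ).map fun q => X q.1 := by
    rw [← (measurePreserving_fst (μ := Q) (ν := ρ)).map_eq, Measure.map_map hXm measurable_fst]
    simp [Function.comp_def]
  have hle : ∀ᵐ q ∂Q.prod ρ, ‖q.2‖ ≤ η :=
    (measurePreserving_snd (μ := Q) (ν := ρ)).quasiMeasurePreserving.ae hη
  have hbd : ∀ f : Ω × E → E, (∀ q, ‖f q‖ = ‖q.2‖) → eLpNorm f p (Q.prod ρ) ≤ ENNReal.ofReal η := by
    intro f hf
    refine (eLpNorm_le_of_ae_bound (C := η) (hle.mono fun q hq => (hf q).trans_le hq)).trans ?_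
    simp
  rw [hmap]
  constructor
  · refine (partialCoupling_map (by fun_prop) (by fun_prop) p).mono le_rfl (hbd _ fun q => ?_)
    simp
  · refine (partialCoupling_map (by fun_prop) (by fun_prop) p).mono le_rfl (hbd _ fun q => ?_)
    simp

variable [InnerProductSpace ℝ E]

theorem IsSteinVelocity.partialCoupling_step [CompleteSpace E] (hV : IsSteinVelocity Q X N V)
    (hXm : Measurable X) (hNm : Measurable N) (hVm : Measurable V) (hX2 : MemLp X 2 Q)
    (hN2 : MemLp N 2 Q) (hV2 : MemLp V 2 Q) {p : ℝ≥0∞} (hp : 1 ≤ p) {ρ : Measure E}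
    [IsProbabilityMeasure ρ] {C : ℝ}
    (hρ : ∀ B : Set E, MeasurableSet B → HasC2Bound C fun z => ρ.real {u | z + u ∈ B})
    (θ : ℝ) {h : ℝ} (hh : 0 ≤ h) (hs : 0 ≤ sin h * cos θ) :
    PartialCoupling p ((Q.prod ρ).map fun q => cos θ • X q.1 + sin θ • N q.1 + q.2)
      ((Q.prod ρ).map fun q => cos (θ + h) • X q.1 + sin (θ + h) • N q.1 + q.2)
      (ENNReal.ofReal (C * (∫ ω, ‖V ω‖ ^ 2 ∂Q + ∫ ω, 2 * (‖X ω‖ ^ 2 + ‖N ω‖ ^ 2) ∂Q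
        + ∫ ω, (‖X ω‖ + ‖N ω‖) ∂Q) * h ^ 2))
      (ENNReal.ofReal (sin h * cos θ) * eLpNorm V p Q) := by
  have h1 := partialCoupling_map (Q := Q.prod ρ)
    (Y := fun q => cos θ • X q.1 + sin θ • N q.1 + q.2)
    (Z := fun q => cos θ • X q.1 + sin θ • N q.1 + (sin h * cos θ) • V q.1 + q.2)
    (by fun_prop) (by fun_prop) p
  have h2 : PartialCoupling p
      ((Q.prod ρ).map fun q => cos θ • X q.1 + sin θ • N q.1 + (sin h * cos θ) • V q.1 + q.2)
      ((Q.prod ρ).map fun q => cos (θ + h) • X q.1 + sin (θ + h) • N q.1 + q.2)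
      (ENNReal.ofReal (C * (∫ ω, ‖V ω‖ ^ 2 ∂Q + ∫ ω, 2 * (‖X ω‖ ^ 2 + ‖N ω‖ ^ 2) ∂Q
        + ∫ ω, (‖X ω‖ + ‖N ω‖) ∂Q) * h ^ 2)) 0 := by
    refine partialCoupling_of_measure_le_add fun B hB => ?_
    rw [map_add_prod_apply (Z := fun ω => cos θ • X ω + sin θ • N ω + (sin h * cos θ) • V ω)
      (by fun_prop) hB, map_add_prod_apply
      (Z := fun ω => cos (θ + h) • X ω + sin (θ + h) • N ω) (by fun_prop) hB]
    have := hV.abs_integral_sub_le hXm hNm hVm hX2 hN2 hV2 (hρ B hB) θ hh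
    rw [← ENNReal.ofReal_add (integral_nonneg fun _ => measureReal_nonneg)
      ((abs_nonneg _).trans this)]
    refine ENNReal.ofReal_le_ofReal ?_
    linarith [(abs_le.1 this).2]
  have h3 := PartialCoupling.trans hp h1 h2
  rw [zero_add, add_zero] at h3
  refine h3.mono le_rfl (le_of_eq ?_)
  have : (fun q : Ω × E => cos θ • X q.1 + sin θ • N q.1 + q.2
      - (cos θ • X q.1 + sin θ • N q.1 + (sin h * cos θ) • V q.1 + q.2)) =
      -((sin h * cos θ) • fun q => V q.1) := by
    ext q
    simp only [Pi.neg_apply, Pi.smul_apply]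
    module
  rw [this, eLpNorm_neg, eLpNorm_const_smul, Real.enorm_eq_ofReal hs]
  congr 1
  exact eLpNorm_comp_measurePreserving (f := Prod.fst) hVm.aestronglyMeasurable
    measurePreserving_fst

theorem IsSteinVelocity.partialCoupling_chain [CompleteSpace E] (hV : IsSteinVelocity Q X N V)
    (hXm : Measurable X) (hNm : Measurable N) (hVm : Measurable V) (hX2 : MemLp X 2 Q)
    (hN2 : MemLp N 2 Q) (hV2 : MemLp V 2 Q) {p : ℝ≥0∞} (hp : 1 ≤ p) {ρ : Measure E}
    [IsProbabilityMeasure ρ] {C : ℝ}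
    (hρ : ∀ B : Set E, MeasurableSet B → HasC2Bound C fun z => ρ.real {u | z + u ∈ B})
    {h : ℝ} (hh : 0 ≤ h) (k : ℕ) (hk : k * h ≤ Real.pi / 2) :
    PartialCoupling p ((Q.prod ρ).map fun q => X q.1 + q.2)
      ((Q.prod ρ).map fun q => cos (k * h) • X q.1 + sin (k * h) • N q.1 + q.2)
      (k * ENNReal.ofReal (C * (∫ ω, ‖V ω‖ ^ 2 ∂Q + ∫ ω, 2 * (‖X ω‖ ^ 2 + ‖N ω‖ ^ 2) ∂Q
        + ∫ ω, (‖X ω‖ + ‖N ω‖) ∂Q) * h ^ 2))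
      (ENNReal.ofReal (sin (k * h) + k * h ^ 2 / 2) * eLpNorm V p Q) := by
  induction k with
  | zero =>
    have := partialCoupling_map (Q := Q.prod ρ) (Y := fun q => X q.1 + q.2)
      (Z := fun q => X q.1 + q.2) (by fun_prop) (by fun_prop) p
    simpa using this
  | succ k ih =>
    have hkh : k * h ≤ Real.pi / 2 := by push_cast at hk; linarith
    have hk0 : 0 ≤ k * h := by positivity
    have hpi := Real.pi_pos
    have hhpi : h ≤ Real.pi := by push_cast at hk; linarith
    have hs : 0 ≤ sin h * cos (k * h) :=
      mul_nonneg (Real.sin_nonneg_of_nonneg_of_le_pi hh hhpi)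
        (Real.cos_nonneg_of_neg_pi_div_two_le_of_le (by linarith) hkh)
    have hs' : 0 ≤ sin (k * h) :=
      Real.sin_nonneg_of_nonneg_of_le_pi hk0 (by linarith)
    have h1 := PartialCoupling.trans hp (ih hkh)
      (hV.partialCoupling_step hXm hNm hVm hX2 hN2 hV2 hp hρ (k * h) hh hs)
    have e : ((k + 1 : ℕ) : ℝ) * h = k * h + h := by push_cast; ring
    rw [e]
    refine h1.mono (le_of_eq ?_) ?_
    · push_cast; ring
    · rw [← add_mul, ← ENNReal.ofReal_add (by positivity) hs]
      gcongr ENNReal.ofReal ?_ * _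
      rw [Real.sin_add]
      push_cast
      nlinarith [Real.one_sub_sq_div_two_le_cos (x := h), Real.sin_le_one (k * h),
        mul_le_mul_of_nonneg_left (Real.one_sub_sq_div_two_le_cos (x := h)) hs',
        mul_le_mul_of_nonneg_right (Real.sin_le_one (k * h)) (sq_nonneg h)]

theorem IsSteinVelocity.wassersteinDist_rpow_le [FiniteDimensional ℝ E]
    (hV : IsSteinVelocity Q X N V)
    (hXm : Measurable X) (hNm : Measurable N) (hVm : Measurable V) (hX2 : MemLp X 2 Q)
    (hN2 : MemLp N 2 Q) (hV2 : MemLp V 2 Q) {p : ℝ} (hp : 1 ≤ p)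
    (hVp : MemLp V (ENNReal.ofReal p) Q) (hXp : ∫⁻ ω, (‖X ω‖ₑ ^ p) ^ 2 ∂Q ≠ ⊤)
    (hNp : ∫⁻ ω, (‖N ω‖ₑ ^ p) ^ 2 ∂Q ≠ ⊤) :
    wassersteinDist p (Q.map X) (Q.map N) ^ p ≤
      (eLpNorm V (ENNReal.ofReal p) Q).toReal ^ p := by
  have hp' : 1 ≤ ENNReal.ofReal p := by simpa using hp
  have : CompleteSpace E := FiniteDimensional.complete ℝ E
  have := Measure.isProbabilityMeasure_map (μ := Q) hXm.aemeasurable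
  have := Measure.isProbabilityMeasure_map (μ := Q) hNm.aemeasurable
  refine wassersteinDist_rpow_le_of_partialCoupling hp ?_ ?_ ENNReal.toReal_nonneg fun ε hε => ?_
  · rwa [lintegral_map (by fun_prop) hXm]
  · rwa [lintegral_map (by fun_prop) hNm]
  set R := (eLpNorm V (ENNReal.ofReal p) Q).toReal with hR
  have hRe : eLpNorm V (ENNReal.ofReal p) Q = ENNReal.ofReal R :=
    (ENNReal.ofReal_toReal hVp.eLpNorm_ne_top).symm
  have hR0 : 0 ≤ R := ENNReal.toReal_nonneg
  obtain ⟨ρ, hρp, hρη, C, hρ⟩ := exists_smoothing_measure (volume : Measure E) (η := ε / 4)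
    (by positivity)
  set D := C * (∫ ω, ‖V ω‖ ^ 2 ∂Q + ∫ ω, 2 * (‖X ω‖ ^ 2 + ‖N ω‖ ^ 2) ∂Q
        + ∫ ω, (‖X ω‖ + ‖N ω‖) ∂Q) with hD
  have hpi := Real.pi_pos
  obtain ⟨m, hm⟩ := exists_nat_gt (max 1 (max (|D| * Real.pi ^ 2 / ε) (Real.pi ^ 2 * R / ε)))
  simp only [max_lt_iff] at hm
  obtain ⟨hm1, hmD, hmR⟩ := hm
  have hm0 : (0 : ℝ) < m := by linarith
  set h := Real.pi / 2 / m with hh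
  have hh0 : 0 ≤ h := by positivity
  have hmh : m * h = Real.pi / 2 := by rw [hh]; field_simp
  have hmid := hV.partialCoupling_chain hXm hNm hVm hX2 hN2 hV2 hp' hρ hh0 m hmh.le
  simp only [hmh, Real.cos_pi_div_two, Real.sin_pi_div_two, zero_smul, zero_add, one_smul,
    ← hD] at hmid
  have h1 := (partialCoupling_map_add_prod (Q := Q) (p := ENNReal.ofReal p) hρη hXm).1
  have h2 := (partialCoupling_map_add_prod (Q := Q) (p := ENNReal.ofReal p) hρη hNm).2
  have h3 := (h1.trans hp' hmid).trans hp' h2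
  have hmh2 : m * h ^ 2 = Real.pi ^ 2 / 4 / m := by rw [hh]; field_simp; norm_num
  refine h3.mono ?_ ?_
  · rw [zero_add, add_zero, ← ENNReal.ofReal_natCast, ← ENNReal.ofReal_mul (by positivity)]
    refine ENNReal.ofReal_le_ofReal ?_
    rw [div_lt_iff₀ hε] at hmD
    calc (m : ℝ) * (D * h ^ 2) = D * (Real.pi ^ 2 / 4 / m) := by rw [← hmh2]; ring
      _ ≤ |D| * (Real.pi ^ 2 / 4 / m) := by gcongr; exact le_abs_self D
      _ ≤ ε := by
        rw [← mul_div_assoc, div_le_iff₀ hm0]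
        nlinarith [mul_nonneg (abs_nonneg D) (sq_nonneg Real.pi)]
  · rw [hRe, ← ENNReal.ofReal_mul (by positivity), ← ENNReal.ofReal_add (by positivity)
      (by positivity), ← ENNReal.ofReal_add (by positivity) (by positivity)]
    refine ENNReal.ofReal_le_ofReal ?_
    rw [div_lt_iff₀ hε] at hmR
    have : m * h ^ 2 / 2 * R ≤ ε / 2 := by
      rw [hmh2]
      calc Real.pi ^ 2 / 4 / m / 2 * R = (Real.pi ^ 2 * R / 8) / m := by ring
        _ ≤ ε / 2 := by
          rw [div_le_iff₀ hm0]
          nlinarith [mul_nonneg hR0 (sq_nonneg Real.pi)]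
    linarith

end Chaining

/-! ### Gaussian integration by parts -/

section GaussianIntegrationByParts

theorem hasDerivAt_gaussianPDFReal (t : ℝ) :
    HasDerivAt (gaussianPDFReal 0 1) (-t * gaussianPDFReal 0 1 t) t := by
  have h : HasDerivAt (fun t : ℝ => -t ^ 2 / 2) (-t) t :=
    (((hasDerivAt_id' t).fun_pow 2).fun_neg.div_const 2).congr_deriv (by norm_num; ring)
  have h2 := (h.exp).const_mul (√(2 * Real.pi))⁻¹
  simp only [gaussianPDFReal_def, NNReal.coe_one, mul_one, sub_zero]
  exact h2.congr_deriv (by ring)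

theorem integrable_gaussianReal_iff {f : ℝ → ℝ} :
    Integrable f (gaussianReal 0 1) ↔ Integrable fun t => gaussianPDFReal 0 1 t * f t := by
  rw [gaussianReal_of_var_ne_zero 0 one_ne_zero,
    integrable_withDensity_iff_integrable_smul' (measurable_gaussianPDF 0 1)
      (Eventually.of_forall fun _ => gaussianPDF_lt_top)]
  simp only [toReal_gaussianPDF, smul_eq_mul]

theorem integral_id_mul_gaussianReal {g g' : ℝ → ℝ} (hg : ∀ t, HasDerivAt g (g' t) t) {C : ℝ}
    (hC : ∀ t, |g t| ≤ C) (hC' : ∀ t, |g' t| ≤ C) :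
    ∫ t, t * g t ∂gaussianReal 0 1 = ∫ t, g' t ∂gaussianReal 0 1 := by
  have hgc : Continuous g := continuous_iff_continuousAt.2 fun t => (hg t).continuousAt
  have hg'm : Measurable g' := by
    have : g' = deriv g := funext fun t => (hg t).deriv.symm
    rw [this]; exact measurable_deriv g
  have hid : Integrable (fun t : ℝ => t) (gaussianReal 0 1) :=
    (memLp_id_gaussianReal 1).integrable le_rfl
  have i1 : Integrable g (gaussianReal 0 1) :=
    Integrable.of_bound hgc.aestronglyMeasurable C (Eventually.of_forall hC)
  have i2 : Integrable g' (gaussianReal 0 1) :=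
    Integrable.of_bound hg'm.aestronglyMeasurable C (Eventually.of_forall hC')
  have i3 : Integrable (fun t => t * g t) (gaussianReal 0 1) :=
    hid.mul_bdd hgc.aestronglyMeasurable (Eventually.of_forall hC)
  rw [integrable_gaussianReal_iff] at i1 i2 i3
  have key := integral_mul_deriv_eq_deriv_mul_of_integrable (u := g) (u' := g')
    (v := gaussianPDFReal 0 1) (v' := fun t => -t * gaussianPDFReal 0 1 t)
    (fun t _ => hg t) (fun t _ => hasDerivAt_gaussianPDFReal t)
    (i3.neg.congr (Eventually.of_forall fun t => by
      simp only [Pi.neg_apply, Pi.mul_apply]; ring))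
    (i2.congr (Eventually.of_forall fun t => by simp only [Pi.mul_apply]; ring))
    (i1.congr (Eventually.of_forall fun t => by simp only [Pi.mul_apply]; ring))
  rw [integral_gaussianReal_eq_integral_smul one_ne_zero,
    integral_gaussianReal_eq_integral_smul one_ne_zero]
  simp only [smul_eq_mul]
  calc ∫ t, gaussianPDFReal 0 1 t * (t * g t)
      = -∫ t, g t * (-t * gaussianPDFReal 0 1 t) := by
        rw [← integral_neg]; congr 1; ext t; ring
    _ = ∫ t, gaussianPDFReal 0 1 t * g' t := by
        rw [key, neg_neg]; congr 1; ext t; ring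

variable {d : ℕ}

theorem stdGaussianE_eq_stdGaussian (d : ℕ) :
    stdGaussianE d = stdGaussian (EuclideanSpace ℝ (Fin d)) :=
  map_pi_eq_stdGaussian

instance : IsGaussian (stdGaussianE d) := by
  rw [stdGaussianE_eq_stdGaussian]; infer_instance

theorem memLp_id_stdGaussianE {p : ℝ≥0∞} (hp : p ≠ ⊤) : MemLp id p (stdGaussianE d) :=
  IsGaussian.memLp_id _ p hp

theorem integral_coord_mul_stdGaussianE {g : EuclideanSpace ℝ (Fin d) → ℝ}
    (hg : ContDiff ℝ 1 g) {C : ℝ} (hC : ∀ y, |g y| ≤ C) (hC' : ∀ y, ‖fderiv ℝ g y‖ ≤ C)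
    (j : Fin d) :
    ∫ y, y j * g y ∂stdGaussianE d =
      ∫ y, fderiv ℝ g y (EuclideanSpace.single j 1) ∂stdGaussianE d := by
  cases d with
  | zero => exact j.elim0
  | succ d =>
  have hmp := (measurePreserving_piFinSuccAbove (fun _ : Fin (d + 1) => gaussianReal 0 1) j).symm
  set γ := (gaussianReal 0 1).prod (Measure.pi fun _ : Fin d => gaussianReal 0 1)
  set T : ℝ × (Fin d → ℝ) → EuclideanSpace ℝ (Fin (d + 1)) :=
    fun q => WithLp.toLp 2 (Fin.insertNth (α := fun _ => ℝ) j q.1 q.2) with hT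
  have hTm : MeasurePreserving T γ (stdGaussianE (d + 1)) :=
    MeasurePreserving.comp ⟨(EuclideanSpace.equiv (Fin (d + 1)) ℝ).symm.continuous.measurable, rfl⟩
      hmp
  have hTline : ∀ t y, T (t, y) = T (0, y) + t • EuclideanSpace.single j (1 : ℝ) := by
    intro t y
    ext i
    refine Fin.succAboveCases j ?_ (fun k => ?_) i
    · simp [hT]
    · simp [hT]
  have hTder : ∀ t y, HasDerivAt (fun t => T (t, y)) (EuclideanSpace.single j (1 : ℝ)) t := by
    intro t y
    rw [funext fun t => hTline t y]
    simpa using ((hasDerivAt_id' t).smul_const (EuclideanSpace.single j (1 : ℝ))).const_add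
      (T (0, y))
  have hc' : Continuous (fderiv ℝ g) := hg.continuous_fderiv one_ne_zero
  have h1 : Integrable (fun y => y j * g y) (stdGaussianE (d + 1)) := by
    refine Integrable.mul_bdd (c := C) ?_ hg.continuous.aestronglyMeasurable
      (Eventually.of_forall hC)
    refine ((memLp_id_stdGaussianE (p := 1) (by simp)).integrable le_rfl).mono
      (by fun_prop) (Eventually.of_forall fun y => ?_)
    exact PiLp.norm_apply_le y j
  have h2 : Integrable (fun y => fderiv ℝ g y (EuclideanSpace.single j (1 : ℝ)))
      (stdGaussianE (d + 1)) := by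
    refine Integrable.of_bound (hc'.clm_apply continuous_const).aestronglyMeasurable C
      (Eventually.of_forall fun y => ?_)
    refine ((fderiv ℝ g y).le_opNorm _).trans ?_
    simpa using hC' y
  rw [← hTm.map_eq] at h1 h2 ⊢
  rw [integral_map hTm.aemeasurable h1.aestronglyMeasurable,
    integral_map hTm.aemeasurable h2.aestronglyMeasurable,
    integral_prod_symm (fun q => T q j * g (T q)) (h1.comp_aemeasurable hTm.aemeasurable),
    integral_prod_symm (fun q => fderiv ℝ g (T q) (EuclideanSpace.single j (1 : ℝ)))
      (h2.comp_aemeasurable hTm.aemeasurable)]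
  congr 1
  ext y
  have hTj : ∀ t, T (t, y) j = t := fun t => by simp [hT]
  simp only [hTj]
  refine integral_id_mul_gaussianReal (C := C) (fun t => ?_) (fun t => hC _) fun t => ?_
  · exact ((hg.differentiable one_ne_zero _).hasFDerivAt).comp_hasDerivAt t (hTder t y)
  · refine ((fderiv ℝ g (T (t, y))).le_opNorm _).trans ?_
    simpa using hC' _

end GaussianIntegrationByParts

/-! ### Integration by parts for Gibbs measures -/

section Gibbs

variable {n : ℕ}

theorem pd_eq_fderiv {F : (Fin n → ℝ) → ℝ} {x : Fin n → ℝ} (hF : DifferentiableAt ℝ F x)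
    (i : Fin n) : pd i F x = fderiv ℝ F x (Pi.single i 1) := by
  have h : HasDerivAt (fun t => Function.update x i t) (Pi.single i 1) (x i) :=
    hasDerivAt_update x i (x i)
  have hF' : HasFDerivAt F (fderiv ℝ F x) (Function.update x i (x i)) := by
    rw [Function.update_eq_self]; exact hF.hasFDerivAt
  exact (hF'.comp_hasDerivAt (x i) h).deriv

theorem pd_eq_fderiv_of_contDiff {F : (Fin n → ℝ) → ℝ} (hF : ContDiff ℝ 1 F) (i : Fin n) :
    pd i F = fun x => fderiv ℝ F x (Pi.single i 1) :=
  funext fun x => pd_eq_fderiv (hF.differentiable one_ne_zero x) i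

theorem contDiff_pd {F : (Fin n → ℝ) → ℝ} {k : WithTop ℕ∞} (hF : ContDiff ℝ (k + 1) F)
    (i : Fin n) : ContDiff ℝ k (pd i F) := by
  rw [pd_eq_fderiv_of_contDiff (hF.of_le le_add_self)]
  exact (hF.fderiv_right le_rfl).clm_apply contDiff_const

theorem continuous_pd {F : (Fin n → ℝ) → ℝ} (hF : ContDiff ℝ 1 F) (i : Fin n) :
    Continuous (pd i F) :=
  (contDiff_pd (k := 0) (by simpa using hF) i).continuous

theorem hasCompactSupport_pd {F : (Fin n → ℝ) → ℝ} (hF : ContDiff ℝ 1 F)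
    (hc : HasCompactSupport F) (i : Fin n) : HasCompactSupport (pd i F) := by
  rw [pd_eq_fderiv_of_contDiff hF]
  exact hc.fderiv_apply ℝ _

theorem cdc_comm (F G : (Fin n → ℝ) → ℝ) (x : Fin n → ℝ) : cdc F G x = cdc G F x := by
  simp only [cdc, mul_comm]

theorem continuous_cdc {F G : (Fin n → ℝ) → ℝ} (hF : ContDiff ℝ 1 F) (hG : ContDiff ℝ 1 G) :
    Continuous (cdc F G) :=
  continuous_finsetSum _ fun i _ => (continuous_pd hF i).mul (continuous_pd hG i)

theorem hasCompactSupport_finsetSum {ι α : Type*} [TopologicalSpace α] {f : ι → α → ℝ}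
    (s : Finset ι) (h : ∀ i ∈ s, HasCompactSupport (f i)) :
    HasCompactSupport fun x => ∑ i ∈ s, f i x := by
  classical
  induction s using Finset.induction_on with
  | empty => exact HasCompactSupport.zero
  | insert a s ha ih =>
    simp only [Finset.sum_insert ha]
    exact (h a (Finset.mem_insert_self a s)).add
      (ih fun i hi => h i (Finset.mem_insert_of_mem hi))

theorem hasCompactSupport_cdc {F : (Fin n → ℝ) → ℝ} (hF : ContDiff ℝ 1 F)
    (hc : HasCompactSupport F) (G : (Fin n → ℝ) → ℝ) : HasCompactSupport (cdc F G) :=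
  hasCompactSupport_finsetSum _ fun i _ => (hasCompactSupport_pd hF hc i).mul_right

variable {W : (Fin n → ℝ) → ℝ}

theorem IsCcInfty.contDiff_nat {F : (Fin n → ℝ) → ℝ} (hF : IsCcInfty F) (k : ℕ) :
    ContDiff ℝ k F :=
  hF.1.of_le (by exact_mod_cast le_top)

theorem IsCcInfty.contDiff_one {F : (Fin n → ℝ) → ℝ} (hF : IsCcInfty F) : ContDiff ℝ 1 F := by
  exact_mod_cast hF.contDiff_nat 1

theorem IsCcInfty.contDiff_pd {F : (Fin n → ℝ) → ℝ} (hF : IsCcInfty F) (i : Fin n) :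
    ContDiff ℝ 2 (pd i F) :=
  _root_.contDiff_pd (by exact_mod_cast hF.contDiff_nat 3) i

theorem IsCcInfty.contDiff_genL {F : (Fin n → ℝ) → ℝ} (hF : IsCcInfty F)
    (hW : ContDiff ℝ 2 W) : ContDiff ℝ 1 (genL W F) := by
  refine ContDiff.sub (ContDiff.sum fun i _ => ?_) (ContDiff.sum fun i _ => ?_)
  · exact _root_.contDiff_pd (hF.contDiff_pd i) i
  · exact (_root_.contDiff_pd hW i).mul ((hF.contDiff_pd i).of_le one_le_two)

theorem IsCcInfty.hasCompactSupport_genL {F : (Fin n → ℝ) → ℝ} (hF : IsCcInfty F)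
    (W : (Fin n → ℝ) → ℝ) : HasCompactSupport (genL W F) := by
  have hp := fun i => hasCompactSupport_pd hF.contDiff_one hF.2 i
  have h1 : HasCompactSupport fun x => ∑ i, pd i (pd i F) x :=
    hasCompactSupport_finsetSum _ fun i _ =>
      hasCompactSupport_pd ((hF.contDiff_pd i).of_le one_le_two) (hp i) i
  have h2 : HasCompactSupport (cdc W F) :=
    hasCompactSupport_finsetSum _ fun i _ => (hp i).mul_left
  exact h1.sub h2

theorem gibbsZ_pos (hZ : Integrable fun x : Fin n → ℝ => Real.exp (-W x)) : 0 < gibbsZ W :=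
  integral_exp_pos hZ

theorem isProbabilityMeasure_gibbsP (hZ : Integrable fun x : Fin n → ℝ => Real.exp (-W x)) :
    IsProbabilityMeasure (gibbsP W) := by
  have hZ0 := gibbsZ_pos hZ
  refine ⟨?_⟩
  rw [gibbsP, withDensity_apply _ MeasurableSet.univ, Measure.restrict_univ,
    ← ofReal_integral_eq_lintegral_ofReal (hZ.div_const _)
      (Eventually.of_forall fun x => by positivity), integral_div]
  change ENNReal.ofReal (gibbsZ W / gibbsZ W) = 1
  rw [div_self hZ0.ne', ENNReal.ofReal_one]

theorem integral_gibbsP (hW : Continuous W)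
    (hZ : Integrable fun x : Fin n → ℝ => Real.exp (-W x)) (f : (Fin n → ℝ) → ℝ) :
    ∫ x, f x ∂gibbsP W = ∫ x, Real.exp (-W x) / gibbsZ W * f x := by
  have hZ0 := gibbsZ_pos hZ
  rw [gibbsP, integral_withDensity_eq_integral_toReal_smul (by fun_prop)
    (Eventually.of_forall fun _ => ENNReal.ofReal_lt_top)]
  congr 1
  ext x
  rw [ENNReal.toReal_ofReal (by positivity), smul_eq_mul]

theorem integral_genL_mul (hW : ContDiff ℝ 2 W)
    (hZ : Integrable fun x : Fin n → ℝ => Real.exp (-W x)) {F u : (Fin n → ℝ) → ℝ}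
    (hF : IsCcInfty F) (hu : ContDiff ℝ 1 u) :
    ∫ x, genL W F x * u x ∂gibbsP W = -∫ x, cdc F u x ∂gibbsP W := by
  have hW1 : ContDiff ℝ 1 W := hW.of_le one_le_two
  rw [integral_gibbsP hW.continuous hZ, integral_gibbsP hW.continuous hZ]
  set w : (Fin n → ℝ) → ℝ := fun x => Real.exp (-W x) / gibbsZ W with hw
  have hwd : ContDiff ℝ 1 w := hW1.neg.exp.div_const _
  have hwu : ContDiff ℝ 1 fun x => w x * u x := hwd.mul hu
  have hpd : ∀ i x, pd i (fun x => w x * u x) x = w x * (pd i u x - pd i W x * u x) := by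
    intro i x
    have hWx := (hW1.differentiable one_ne_zero x).hasFDerivAt
    have hux := (hu.differentiable one_ne_zero x).hasFDerivAt
    have hwx : HasFDerivAt w (-w x • fderiv ℝ W x) x := by
      simp only [hw, div_eq_mul_inv]
      refine ((hWx.fun_neg.exp).mul_const (gibbsZ W)⁻¹).congr_fderiv ?_
      ext v
      simp
      ring
    rw [pd_eq_fderiv (hwu.differentiable one_ne_zero x), (hwx.fun_mul hux).fderiv,
      pd_eq_fderiv hux.differentiableAt, pd_eq_fderiv hWx.differentiableAt]
    simp
    ring
  have hcF := fun i => hasCompactSupport_pd hF.contDiff_one hF.2 i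
  have hF1 := fun i => (hF.contDiff_pd i).of_le one_le_two
  have i1 : ∀ i, Integrable fun x => w x * u x * pd i (pd i F) x := fun i =>
    (hwu.continuous.mul (continuous_pd (hF1 i) i)).integrable_of_hasCompactSupport
      (hasCompactSupport_pd (hF1 i) (hcF i) i).mul_left
  have i2 : ∀ i, Integrable fun x => pd i (fun x => w x * u x) x * pd i F x := fun i =>
    ((continuous_pd hwu i).mul (hF1 i).continuous).integrable_of_hasCompactSupport
      (hcF i).mul_left
  have i3 : ∀ i, Integrable fun x => w x * u x * pd i F x := fun i =>
    (hwu.continuous.mul (hF1 i).continuous).integrable_of_hasCompactSupport (hcF i).mul_left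
  have i4 : ∀ i, Integrable fun x => w x * u x * (pd i W x * pd i F x) := fun i =>
    (hwu.continuous.mul ((continuous_pd hW1 i).mul
      (hF1 i).continuous)).integrable_of_hasCompactSupport ((hcF i).mul_left).mul_left
  have ibp : ∀ i, ∫ x, w x * u x * pd i (pd i F) x =
      -∫ x, pd i (fun x => w x * u x) x * pd i F x := by
    intro i
    have i1' := i1 i
    have i2' := i2 i
    rw [pd_eq_fderiv_of_contDiff (hF1 i)] at i1' ⊢
    rw [pd_eq_fderiv_of_contDiff hwu] at i2' ⊢
    exact integral_mul_fderiv_eq_neg_fderiv_mul_of_integrable i2' i1' (i3 i)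
      (fun x _ => hwu.differentiable one_ne_zero x)
      (fun x _ => (hF1 i).differentiable one_ne_zero x)
  calc ∫ x, w x * (genL W F x * u x)
      = ∫ x, ∑ i, (w x * u x * pd i (pd i F) x - w x * u x * (pd i W x * pd i F x)) := by
        congr 1
        ext x
        rw [Finset.sum_sub_distrib, ← Finset.mul_sum, ← Finset.mul_sum, genL, cdc]
        ring
    _ = ∑ i, (-(∫ x, pd i (fun x => w x * u x) x * pd i F x)
          - ∫ x, w x * u x * (pd i W x * pd i F x)) := by
        rw [integral_finsetSum]
        swap
        · exact fun i _ => (i1 i).sub (i4 i)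
        exact Finset.sum_congr rfl fun i _ => by rw [integral_sub (i1 i) (i4 i), ibp]
    _ = ∑ i, -∫ x, w x * (pd i F x * pd i u x) := by
        refine Finset.sum_congr rfl fun i _ => ?_
        rw [← neg_add', ← integral_add (i2 i) (i4 i)]
        congr 2
        ext x
        rw [hpd]
        ring
    _ = -∫ x, w x * cdc F u x := by
        rw [Finset.sum_neg_distrib, ← integral_finsetSum]
        · simp only [cdc, Finset.mul_sum]
        · exact fun i _ => (hwd.continuous.mul ((hF1 i).continuous.mul
            (continuous_pd hu i))).integrable_of_hasCompactSupport
            ((hcF i).mul_right).mul_left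

end Gibbs

/-! ### The Stein kernel of a vector of generators -/

section SteinKernel

variable {n d : ℕ}

/-- The random vector `(L F₁, …, L F_d)`. -/
def genLVec (W : (Fin n → ℝ) → ℝ) (F : Fin d → (Fin n → ℝ) → ℝ) (x : Fin n → ℝ) :
    EuclideanSpace ℝ (Fin d) :=
  WithLp.toLp 2 fun i => genL W (F i) x

/-- The Stein kernel `K_{ij} = -Γ[F_i, L F_j]` of the random vector `(L F₁, …, L F_d)`. -/
def steinKernel (W : (Fin n → ℝ) → ℝ) (F : Fin d → (Fin n → ℝ) → ℝ) (x : Fin n → ℝ) :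
    Matrix (Fin d) (Fin d) ℝ :=
  Matrix.of fun i j => -cdc (F i) (genL W (F j)) x

/-- The image of the second component under the Stein kernel at the first component. -/
def steinKernelApply (W : (Fin n → ℝ) → ℝ) (F : Fin d → (Fin n → ℝ) → ℝ)
    (q : (Fin n → ℝ) × EuclideanSpace ℝ (Fin d)) : EuclideanSpace ℝ (Fin d) :=
  WithLp.toLp 2 fun i => ∑ j, steinKernel W F q.1 i j * q.2 j

variable {W : (Fin n → ℝ) → ℝ} {F : Fin d → (Fin n → ℝ) → ℝ}

theorem contDiff_genLVec (hW : ContDiff ℝ 2 W) (hF : ∀ i, IsCcInfty (F i)) :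
    ContDiff ℝ 1 (genLVec W F) :=
  contDiff_euclidean.2 fun i => (hF i).contDiff_genL hW

theorem continuous_steinKernel (hW : ContDiff ℝ 2 W) (hF : ∀ i, IsCcInfty (F i)) (i j : Fin d) :
    Continuous fun x => steinKernel W F x i j :=
  (continuous_cdc (hF i).contDiff_one ((hF j).contDiff_genL hW)).neg

theorem continuous_steinKernelApply (hW : ContDiff ℝ 2 W) (hF : ∀ i, IsCcInfty (F i)) :
    Continuous (steinKernelApply W F) := by
  have := fun i j => continuous_steinKernel hW hF i j
  unfold steinKernelApply
  fun_prop

theorem exists_abs_steinKernel_le (hW : ContDiff ℝ 2 W) (hF : ∀ i, IsCcInfty (F i))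
    (i j : Fin d) : ∃ C, ∀ x, |steinKernel W F x i j| ≤ C :=
  (hasCompactSupport_cdc (hF i).contDiff_one (hF i).2 (genL W (F j))).neg.exists_bound_of_continuous
    (continuous_steinKernel hW hF i j)

theorem exists_abs_genL_le (hW : ContDiff ℝ 2 W) {G : (Fin n → ℝ) → ℝ} (hG : IsCcInfty G) :
    ∃ C, ∀ x, |genL W G x| ≤ C :=
  (hG.hasCompactSupport_genL W).exists_bound_of_continuous (hG.contDiff_genL hW).continuous

theorem euclideanSpace_map_eq_sum (f : EuclideanSpace ℝ (Fin d) →L[ℝ] ℝ)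
    (v : EuclideanSpace ℝ (Fin d)) : f v = ∑ i, v i * f (EuclideanSpace.single i 1) := by
  conv_lhs => rw [← (EuclideanSpace.basisFun (Fin d) ℝ).sum_repr v]
  simp

theorem cdc_comp_genLVec (hW : ContDiff ℝ 2 W) (hF : ∀ i, IsCcInfty (F i))
    {g : EuclideanSpace ℝ (Fin d) → ℝ} (hg : ContDiff ℝ 1 g) (c : ℝ)
    (a : EuclideanSpace ℝ (Fin d)) (i : Fin d) (x : Fin n → ℝ) :
    -cdc (F i) (fun x => g (c • genLVec W F x + a)) x =
      c * ∑ j, steinKernel W F x i j *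
        fderiv ℝ g (c • genLVec W F x + a) (EuclideanSpace.single j 1) := by
  have hX := ((contDiff_genLVec hW hF).differentiable one_ne_zero x).hasFDerivAt
  have hgx := (hg.differentiable one_ne_zero (c • genLVec W F x + a)).hasFDerivAt
  have hcomp : HasFDerivAt (fun x => g (c • genLVec W F x + a)) _ x :=
    hgx.comp x ((hX.const_smul c).add_const a)
  have hcoord : ∀ k j, fderiv ℝ (genLVec W F) x (Pi.single k 1) j = pd k (genL W (F j)) x := by
    intro k j
    have h : HasFDerivAt (genL W (F j))
        ((EuclideanSpace.proj j : EuclideanSpace ℝ (Fin d) →L[ℝ] ℝ) ∘L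
          fderiv ℝ (genLVec W F) x) x :=
      ((EuclideanSpace.proj j : EuclideanSpace ℝ (Fin d) →L[ℝ] ℝ).hasFDerivAt).comp x hX
    rw [pd_eq_fderiv h.differentiableAt, h.fderiv]
    rfl
  have hpd : ∀ k, pd k (fun x => g (c • genLVec W F x + a)) x =
      c * ∑ j, pd k (genL W (F j)) x *
        fderiv ℝ g (c • genLVec W F x + a) (EuclideanSpace.single j 1) := by
    intro k
    rw [pd_eq_fderiv hcomp.differentiableAt, hcomp.fderiv]
    simp only [ContinuousLinearMap.comp_apply, smul_apply, map_smul,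
      smul_eq_mul]
    rw [euclideanSpace_map_eq_sum]
    simp only [hcoord]
  simp only [cdc, hpd, steinKernel, Matrix.of_apply, Finset.mul_sum, ← Finset.sum_neg_distrib,
    Finset.sum_mul]
  rw [Finset.sum_comm]
  refine Finset.sum_congr rfl fun j _ => Finset.sum_congr rfl fun k _ => ?_
  ring

theorem HasC2Bound.contDiff_fderiv_apply {E : Type*} [NormedAddCommGroup E] [NormedSpace ℝ E]
    {C : ℝ} {φ : E → ℝ} (h : HasC2Bound C φ) (v : E) :
    ContDiff ℝ 1 fun z => fderiv ℝ φ z v :=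
  h.contDiff_fderiv.clm_apply contDiff_const

theorem HasC2Bound.norm_fderiv_fderiv_apply_le {E : Type*} [NormedAddCommGroup E]
    [NormedSpace ℝ E] {C : ℝ} {φ : E → ℝ} (h : HasC2Bound C φ) (v z : E) :
    ‖fderiv ℝ (fun z => fderiv ℝ φ z v) z‖ ≤ C * ‖v‖ := by
  have hz := (h.contDiff_fderiv.differentiable one_ne_zero z).hasFDerivAt
  rw [(hz.clm_apply (hasFDerivAt_const v z)).fderiv]
  refine ContinuousLinearMap.opNorm_le_bound _ (by have := h.nonneg; positivity) fun w => ?_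
  simp only [add_apply, ContinuousLinearMap.comp_apply,
    ContinuousLinearMap.flip_apply, zero_apply, map_zero, zero_add]
  calc ‖fderiv ℝ (fderiv ℝ φ) z w v‖ ≤ ‖fderiv ℝ (fderiv ℝ φ) z w‖ * ‖v‖ :=
        ContinuousLinearMap.le_opNorm _ _
    _ ≤ C * ‖w‖ * ‖v‖ := by
        gcongr
        exact ContinuousLinearMap.le_of_opNorm_le _ (h.fderiv_fderiv_le z) w
    _ = C * ‖v‖ * ‖w‖ := by ring

theorem integrable_steinKernel_mul (hW : ContDiff ℝ 2 W)
    (hZ : Integrable fun x : Fin n → ℝ => Real.exp (-W x)) (hF : ∀ i, IsCcInfty (F i))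
    (i j : Fin d) {D : EuclideanSpace ℝ (Fin d) → EuclideanSpace ℝ (Fin d) →L[ℝ] ℝ}
    (hD : Continuous D) {C : ℝ} (hC : ∀ z, ‖D z‖ ≤ C) (c s : ℝ) :
    Integrable (fun q : (Fin n → ℝ) × EuclideanSpace ℝ (Fin d) =>
      steinKernel W F q.1 i j * D (c • genLVec W F q.1 + s • q.2) (EuclideanSpace.single j 1))
      ((gibbsP W).prod (stdGaussianE d)) := by
  have := isProbabilityMeasure_gibbsP hZ
  have hXc := (contDiff_genLVec hW hF).continuous
  have hKc := continuous_steinKernel hW hF i j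
  obtain ⟨B, hB⟩ := exists_abs_steinKernel_le hW hF i j
  refine Integrable.of_bound (Continuous.aestronglyMeasurable (by fun_prop)) (B * C)
    (Eventually.of_forall fun q => ?_)
  rw [norm_mul]
  gcongr
  · exact (abs_nonneg _).trans (hB q.1)
  · exact hB _
  · exact (ContinuousLinearMap.le_opNorm _ _).trans (by simpa using hC _)

theorem integral_fderiv_steinKernelApply (hW : ContDiff ℝ 2 W)
    (hZ : Integrable fun x : Fin n → ℝ => Real.exp (-W x)) (hF : ∀ i, IsCcInfty (F i)) {C : ℝ}
    {φ : EuclideanSpace ℝ (Fin d) → ℝ} (hφ : HasC2Bound C φ) (c s : ℝ) :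
    ∫ q, fderiv ℝ φ (c • genLVec W F q.1 + s • q.2) (steinKernelApply W F q)
        ∂(gibbsP W).prod (stdGaussianE d) =
      s * ∑ i, ∑ j, ∫ q, steinKernel W F q.1 i j *
        fderiv ℝ (fun z => fderiv ℝ φ z (EuclideanSpace.single i 1))
          (c • genLVec W F q.1 + s • q.2) (EuclideanSpace.single j 1)
        ∂(gibbsP W).prod (stdGaussianE d) := by
  have := isProbabilityMeasure_gibbsP hZ
  have hXc := (contDiff_genLVec hW hF).continuous
  have hKc := fun i j => continuous_steinKernel hW hF i j
  choose B hB using fun i j => exists_abs_steinKernel_le hW hF i j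
  set g : Fin d → EuclideanSpace ℝ (Fin d) → ℝ :=
    fun i z => fderiv ℝ φ z (EuclideanSpace.single i 1) with hg
  have hgd : ∀ i, ContDiff ℝ 1 (g i) := fun i => hφ.contDiff_fderiv_apply _
  have hgC : ∀ i z, |g i z| ≤ C := fun i z => by
    simpa using hφ.abs_fderiv_apply_le z (EuclideanSpace.single i 1)
  have hgC' : ∀ i z, ‖fderiv ℝ (g i) z‖ ≤ C := fun i z => by
    simpa using hφ.norm_fderiv_fderiv_apply_le (EuclideanSpace.single i 1) z
  have hgc : ∀ i, Continuous (g i) := fun i => (hgd i).continuous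
  have hgc' : ∀ i, Continuous (fderiv ℝ (g i)) := fun i => (hgd i).continuous_fderiv one_ne_zero
  have hNi : ∀ j, Integrable (fun q : (Fin n → ℝ) × EuclideanSpace ℝ (Fin d) => q.2 j)
      ((gibbsP W).prod (stdGaussianE d)) := fun j => by
    refine Integrable.comp_snd (f := fun y : EuclideanSpace ℝ (Fin d) => y j) ?_ _
    refine ((memLp_id_stdGaussianE (p := 1) (by simp)).integrable le_rfl).mono
      (by fun_prop) (Eventually.of_forall fun y => ?_)
    exact PiLp.norm_apply_le y j
  have hint : ∀ i j, Integrable (fun q : (Fin n → ℝ) × EuclideanSpace ℝ (Fin d) =>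
      steinKernel W F q.1 i j * (q.2 j * g i (c • genLVec W F q.1 + s • q.2)))
      ((gibbsP W).prod (stdGaussianE d)) := fun i j => by
    refine Integrable.bdd_mul (c := B i j) ?_ ?_ ?_
    · refine (hNi j).mul_bdd (c := C) (Continuous.aestronglyMeasurable (by fun_prop))
        (Eventually.of_forall fun q => hgC i _)
    · exact Continuous.aestronglyMeasurable (by fun_prop)
    · exact Eventually.of_forall fun q => hB i j _
  have hint' := fun i j => integrable_steinKernel_mul hW hZ hF i j (hgc' i) (hgC' i) c s
  calc _ = ∫ q, ∑ i, ∑ j, steinKernel W F q.1 i j *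
          (q.2 j * g i (c • genLVec W F q.1 + s • q.2)) ∂(gibbsP W).prod (stdGaussianE d) := by
        congr 1
        ext q
        rw [euclideanSpace_map_eq_sum]
        simp only [steinKernelApply, Finset.sum_mul, hg, mul_assoc]
    _ = ∑ i, ∑ j, ∫ q, steinKernel W F q.1 i j *
          (q.2 j * g i (c • genLVec W F q.1 + s • q.2)) ∂(gibbsP W).prod (stdGaussianE d) := by
        rw [integral_finsetSum _ fun i _ => integrable_finsetSum _ fun j _ => hint i j]
        exact Finset.sum_congr rfl fun i _ => integral_finsetSum _ fun j _ => hint i j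
    _ = _ := by
        rw [Finset.mul_sum]
        refine Finset.sum_congr rfl fun i _ => ?_
        rw [Finset.mul_sum]
        refine Finset.sum_congr rfl fun j _ => ?_
        rw [integral_prod _ (hint i j), integral_prod _ (hint' i j), ← integral_const_mul]
        congr 1
        ext x
        simp only [integral_const_mul]
        have hder : ∀ y, HasFDerivAt (fun y => g i (c • genLVec W F x + s • y))
            (s • fderiv ℝ (g i) (c • genLVec W F x + s • y)) y := fun y => by
          have h1 := ((hgd i).differentiable one_ne_zero
            (c • genLVec W F x + s • y)).hasFDerivAt
          refine (h1.comp y (((hasFDerivAt_id y).const_smul s).const_add _)).congr_fderiv ?_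
          ext v
          simp
        have hC0 := hφ.nonneg
        rw [integral_coord_mul_stdGaussianE (g := fun y => g i (c • genLVec W F x + s • y))
          (C := max C (|s| * C))
          ((hgd i).comp (contDiff_const.add (contDiff_id.const_smul s)))
          (fun y => (hgC i _).trans (le_max_left _ _)) (fun y => ?_) j]
        · simp only [(hder _).fderiv, smul_apply, smul_eq_mul,
            integral_const_mul]
          ring
        · rw [(hder y).fderiv, norm_smul]
          refine le_trans ?_ (le_max_right _ _)
          gcongr
          · exact le_rfl
          · exact hgC' i _

theorem integral_fderiv_genLVec (hW : ContDiff ℝ 2 W)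
    (hZ : Integrable fun x : Fin n → ℝ => Real.exp (-W x)) (hF : ∀ i, IsCcInfty (F i)) {C : ℝ}
    {φ : EuclideanSpace ℝ (Fin d) → ℝ} (hφ : HasC2Bound C φ) (c s : ℝ) :
    ∫ q, fderiv ℝ φ (c • genLVec W F q.1 + s • q.2) (genLVec W F q.1)
        ∂(gibbsP W).prod (stdGaussianE d) =
      c * ∑ i, ∑ j, ∫ q, steinKernel W F q.1 i j *
        fderiv ℝ (fun z => fderiv ℝ φ z (EuclideanSpace.single i 1))
          (c • genLVec W F q.1 + s • q.2) (EuclideanSpace.single j 1)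
        ∂(gibbsP W).prod (stdGaussianE d) := by
  have := isProbabilityMeasure_gibbsP hZ
  have hXc := (contDiff_genLVec hW hF).continuous
  have hLc := fun i => ((hF i).contDiff_genL hW).continuous
  choose A hA using fun i => exists_abs_genL_le hW (hF i)
  set g : Fin d → EuclideanSpace ℝ (Fin d) → ℝ :=
    fun i z => fderiv ℝ φ z (EuclideanSpace.single i 1) with hg
  have hgd : ∀ i, ContDiff ℝ 1 (g i) := fun i => hφ.contDiff_fderiv_apply _
  have hgC : ∀ i z, |g i z| ≤ C := fun i z => by
    simpa using hφ.abs_fderiv_apply_le z (EuclideanSpace.single i 1)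
  have hgC' : ∀ i z, ‖fderiv ℝ (g i) z‖ ≤ C := fun i z => by
    simpa using hφ.norm_fderiv_fderiv_apply_le (EuclideanSpace.single i 1) z
  have hgc : ∀ i, Continuous (g i) := fun i => (hgd i).continuous
  have hgc' : ∀ i, Continuous (fderiv ℝ (g i)) := fun i => (hgd i).continuous_fderiv one_ne_zero
  have hint : ∀ i, Integrable (fun q : (Fin n → ℝ) × EuclideanSpace ℝ (Fin d) =>
      genL W (F i) q.1 * g i (c • genLVec W F q.1 + s • q.2))
      ((gibbsP W).prod (stdGaussianE d)) := fun i => by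
    refine Integrable.of_bound (Continuous.aestronglyMeasurable (by fun_prop)) (A i * C)
      (Eventually.of_forall fun q => ?_)
    rw [norm_mul]
    gcongr
    · exact (abs_nonneg _).trans (hA i q.1)
    · exact hA i _
    · exact hgC i _
  have hint' := fun i j => integrable_steinKernel_mul hW hZ hF i j (hgc' i) (hgC' i) c s
  calc _ = ∫ q, ∑ i, genL W (F i) q.1 * g i (c • genLVec W F q.1 + s • q.2)
          ∂(gibbsP W).prod (stdGaussianE d) := by
        congr 1
        ext q
        rw [euclideanSpace_map_eq_sum]
        simp only [genLVec, hg]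
    _ = ∑ i, ∫ q, genL W (F i) q.1 * g i (c • genLVec W F q.1 + s • q.2)
          ∂(gibbsP W).prod (stdGaussianE d) := integral_finsetSum _ fun i _ => hint i
    _ = _ := by
        rw [Finset.mul_sum]
        refine Finset.sum_congr rfl fun i _ => ?_
        rw [← integral_finsetSum _ fun j _ => hint' i j, ← integral_const_mul,
          integral_prod_symm _ (hint i), integral_prod_symm _
            ((integrable_finsetSum _ fun j _ => hint' i j).const_mul c)]
        congr 1
        ext y
        simp only
        rw [integral_genL_mul hW hZ (hF i) (u := fun x => g i (c • genLVec W F x + s • y))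
          ((hgd i).comp (((contDiff_genLVec hW hF).const_smul c).add contDiff_const)),
          ← integral_neg]
        simp only [cdc_comp_genLVec hW hF (hgd i)]

theorem frobeniusNorm_transpose (A : Matrix (Fin d) (Fin d) ℝ) :
    frobeniusNorm A.transpose = frobeniusNorm A := by
  rw [frobeniusNorm, frobeniusNorm, Finset.sum_comm]
  rfl

theorem norm_toLp_sum_mul_le (A : Matrix (Fin d) (Fin d) ℝ) (y : EuclideanSpace ℝ (Fin d)) :
    ‖(WithLp.toLp 2 fun i => ∑ j, A i j * y j : EuclideanSpace ℝ (Fin d))‖ ≤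
      frobeniusNorm A * ‖y‖ := by
  have h0 : 0 ≤ ∑ i, ∑ j, A i j ^ 2 :=
    Finset.sum_nonneg fun i _ => Finset.sum_nonneg fun j _ => sq_nonneg _
  rw [EuclideanSpace.norm_eq, EuclideanSpace.norm_eq, frobeniusNorm, ← Real.sqrt_mul h0]
  refine Real.sqrt_le_sqrt ?_
  rw [Finset.sum_mul]
  refine Finset.sum_le_sum fun i _ => ?_
  simp only [Real.norm_eq_abs, sq_abs]
  exact Finset.sum_mul_sq_le_sq_mul_sq _ _ _

theorem norm_sub_steinKernelApply_le (q : (Fin n → ℝ) × EuclideanSpace ℝ (Fin d)) :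
    ‖q.2 - steinKernelApply W F q‖ ≤
      frobeniusNorm (1 - Matrix.of fun i j => -cdc (genL W (F i)) (F j) q.1) * ‖q.2‖ := by
  have h : (1 - Matrix.of fun i j => -cdc (genL W (F i)) (F j) q.1) =
      (1 - steinKernel W F q.1).transpose := by
    ext i j
    simp [steinKernel, cdc_comm (genL W (F i)), Matrix.one_apply, eq_comm]
  rw [h, frobeniusNorm_transpose]
  refine le_trans (le_of_eq ?_) (norm_toLp_sum_mul_le (1 - steinKernel W F q.1) q.2)
  congr 1
  ext i
  simp [steinKernelApply, sub_mul, Finset.sum_sub_distrib, Matrix.one_apply]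

theorem continuous_frobeniusNorm_sub (hW : ContDiff ℝ 2 W) (hF : ∀ i, IsCcInfty (F i)) :
    Continuous fun x =>
      frobeniusNorm (1 - Matrix.of fun i j => -cdc (genL W (F i)) (F j) x) := by
  have := fun i j => continuous_cdc ((hF i).contDiff_genL hW) (hF j).contDiff_one
  simp only [frobeniusNorm, Matrix.sub_apply, Matrix.of_apply]
  fun_prop

theorem exists_frobeniusNorm_sub_le (hW : ContDiff ℝ 2 W) (hF : ∀ i, IsCcInfty (F i)) :
    ∃ B, ∀ x, frobeniusNorm (1 - Matrix.of fun i j => -cdc (genL W (F i)) (F j) x) ≤ B := by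
  choose B hB using fun i j => exists_abs_steinKernel_le hW hF i j
  refine ⟨√(∑ i, ∑ j, (1 + B j i) ^ 2), fun x => Real.sqrt_le_sqrt ?_⟩
  refine Finset.sum_le_sum fun i _ => Finset.sum_le_sum fun j _ => ?_
  rw [← sq_abs]
  gcongr
  have h := hB j i x
  rw [Matrix.sub_apply, Matrix.of_apply, cdc_comm]
  refine (abs_sub _ _).trans (add_le_add ?_ h)
  rw [Matrix.one_apply]
  split_ifs <;> simp

theorem memLp_sub_steinKernelApply (hW : ContDiff ℝ 2 W)
    (hZ : Integrable fun x : Fin n → ℝ => Real.exp (-W x)) (hF : ∀ i, IsCcInfty (F i))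
    {p : ℝ≥0∞} (hp : p ≠ ⊤) :
    MemLp (fun q => q.2 - steinKernelApply W F q) p ((gibbsP W).prod (stdGaussianE d)) := by
  have := isProbabilityMeasure_gibbsP hZ
  have hN : MemLp (fun q : (Fin n → ℝ) × EuclideanSpace ℝ (Fin d) => q.2) p
      ((gibbsP W).prod (stdGaussianE d)) := (memLp_id_stdGaussianE hp).comp_snd _
  obtain ⟨B, hB⟩ := exists_frobeniusNorm_sub_le hW hF
  refine hN.of_le_mul (c := B)
    (continuous_snd.sub (continuous_steinKernelApply hW hF)).aestronglyMeasurable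
    (Eventually.of_forall fun q => ?_)
  exact (norm_sub_steinKernelApply_le q).trans (by gcongr; exact hB _)

theorem memLp_genLVec (hW : ContDiff ℝ 2 W)
    (hZ : Integrable fun x : Fin n → ℝ => Real.exp (-W x)) (hF : ∀ i, IsCcInfty (F i))
    (p : ℝ≥0∞) : MemLp (genLVec W F) p (gibbsP W) := by
  have := isProbabilityMeasure_gibbsP hZ
  choose A hA using fun i => exists_abs_genL_le hW (hF i)
  refine MemLp.of_bound (contDiff_genLVec hW hF).continuous.aestronglyMeasurable
    (√(∑ i, A i ^ 2)) (Eventually.of_forall fun x => ?_)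
  rw [EuclideanSpace.norm_eq]
  refine Real.sqrt_le_sqrt (Finset.sum_le_sum fun i _ => ?_)
  gcongr
  exact hA i x

theorem isSteinVelocity_gibbsP (hW : ContDiff ℝ 2 W)
    (hZ : Integrable fun x : Fin n → ℝ => Real.exp (-W x)) (hF : ∀ i, IsCcInfty (F i)) :
    IsSteinVelocity ((gibbsP W).prod (stdGaussianE d)) (fun q => genLVec W F q.1) (fun q => q.2)
      fun q => q.2 - steinKernelApply W F q := by
  have := isProbabilityMeasure_gibbsP hZ
  intro C φ θ hφ
  have hXc := (contDiff_genLVec hW hF).continuous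
  have hKc := continuous_steinKernelApply hW hF
  have hN : Integrable (fun q : (Fin n → ℝ) × EuclideanSpace ℝ (Fin d) => q.2)
      ((gibbsP W).prod (stdGaussianE d)) :=
    ((memLp_id_stdGaussianE (p := 1) (by simp)).integrable le_rfl).comp_snd _
  have hX : Integrable (fun q : (Fin n → ℝ) × EuclideanSpace ℝ (Fin d) => genLVec W F q.1)
      ((gibbsP W).prod (stdGaussianE d)) :=
    ((memLp_genLVec hW hZ hF 1).integrable le_rfl).comp_fst _
  have hK : Integrable (steinKernelApply W F) ((gibbsP W).prod (stdGaussianE d)) := by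
    have := hN.sub ((memLp_sub_steinKernelApply hW hZ hF (p := 1) (by simp)).integrable le_rfl)
    simpa [Pi.sub_def] using this
  set Z : (Fin n → ℝ) × EuclideanSpace ℝ (Fin d) → EuclideanSpace ℝ (Fin d) :=
    fun q => cos θ • genLVec W F q.1 + sin θ • q.2 with hZdef
  have hZm : Measurable Z := Continuous.measurable (by fun_prop)
  have jN := hφ.integrable_fderiv_apply hZm measurable_snd hN
  have jX := hφ.integrable_fderiv_apply hZm
    (Continuous.measurable (by fun_prop : Continuous fun q : (Fin n → ℝ) ×
      EuclideanSpace ℝ (Fin d) => genLVec W F q.1)) hX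
  have jK := hφ.integrable_fderiv_apply hZm hKc.measurable hK
  have e1 := integral_fderiv_steinKernelApply hW hZ hF hφ (cos θ) (sin θ)
  have e2 := integral_fderiv_genLVec hW hZ hF hφ (cos θ) (sin θ)
  simp only [map_smul, map_sub, map_add, smul_eq_mul]
  rw [integral_const_mul, integral_sub jN jK, integral_add (jX.const_mul _) (jN.const_mul _),
    integral_const_mul, integral_const_mul, e1, e2]
  ring

end SteinKernel

/-! ### The Wasserstein bound -/

section WassersteinBound

variable {n d : ℕ} {W : (Fin n → ℝ) → ℝ} {F : Fin d → (Fin n → ℝ) → ℝ}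

theorem MeasureTheory.MemLp.lintegral_enorm_rpow_sq_ne_top {Ω E : Type*} [MeasurableSpace Ω]
    [NormedAddCommGroup E] {Q : Measure Ω} {X : Ω → E} {p : ℝ} (hp : 0 < p)
    (hX : MemLp X (ENNReal.ofReal (p * 2)) Q) : ∫⁻ ω, (‖X ω‖ₑ ^ p) ^ 2 ∂Q ≠ ⊤ := by
  have h := lintegral_rpow_enorm_lt_top_of_eLpNorm_lt_top
    (ENNReal.ofReal_pos.2 (by positivity : 0 < p * 2)).ne' ENNReal.ofReal_ne_top hX.2
  rw [ENNReal.toReal_ofReal (by positivity)] at h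
  refine ne_of_lt (lt_of_eq_of_lt (lintegral_congr fun ω => ?_) h)
  rw [← ENNReal.rpow_natCast, ← ENNReal.rpow_mul, Nat.cast_ofNat]

theorem wassersteinDist_genLVec_rpow_le (hW : ContDiff ℝ 2 W)
    (hZ : Integrable fun x : Fin n → ℝ => Real.exp (-W x)) (hF : ∀ i, IsCcInfty (F i))
    {p : ℝ} (hp : 1 ≤ p) :
    wassersteinDist p ((gibbsP W).map (genLVec W F)) (stdGaussianE d) ^ p ≤
      (∫ y, ‖y‖ ^ p ∂stdGaussianE d) *
        ∫ x, frobeniusNorm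
          (1 - Matrix.of fun i j => -cdc (genL W (F i)) (F j) x) ^ p ∂gibbsP W := by
  have := isProbabilityMeasure_gibbsP hZ
  have hp0 : 0 < p := by linarith
  have hXc := (contDiff_genLVec hW hF).continuous
  have hX : ∀ q, MemLp (fun z : (Fin n → ℝ) × EuclideanSpace ℝ (Fin d) => genLVec W F z.1) q
      ((gibbsP W).prod (stdGaussianE d)) := fun q => (memLp_genLVec hW hZ hF q).comp_fst _
  have hN : ∀ q, q ≠ ⊤ → MemLp (fun z : (Fin n → ℝ) × EuclideanSpace ℝ (Fin d) => z.2) q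
      ((gibbsP W).prod (stdGaussianE d)) := fun q hq => (memLp_id_stdGaussianE hq).comp_snd _
  have hV : ∀ q, q ≠ ⊤ → MemLp (fun z => z.2 - steinKernelApply W F z) q
      ((gibbsP W).prod (stdGaussianE d)) := fun q hq => memLp_sub_steinKernelApply hW hZ hF hq
  have key := (isSteinVelocity_gibbsP hW hZ hF).wassersteinDist_rpow_le
    (hXc.measurable.comp measurable_fst) measurable_snd
    (measurable_snd.sub (continuous_steinKernelApply hW hF).measurable) (hX 2) (hN 2 (by simp))
    (hV 2 (by simp)) hp (hV _ ENNReal.ofReal_ne_top) ((hX _).lintegral_enorm_rpow_sq_ne_top hp0)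
    ((hN _ ENNReal.ofReal_ne_top).lintegral_enorm_rpow_sq_ne_top hp0)
  rw [← Function.comp_def (genLVec W F) Prod.fst,
    ← Measure.map_map hXc.measurable measurable_fst, measurePreserving_fst.map_eq,
    measurePreserving_snd.map_eq] at key
  refine key.trans ?_
  rw [(hV _ ENNReal.ofReal_ne_top).eLpNorm_eq_integral_rpow_norm
    (ENNReal.ofReal_pos.2 hp0).ne' ENNReal.ofReal_ne_top, ENNReal.toReal_ofReal hp0.le,
    ENNReal.toReal_ofReal (by positivity), ← Real.rpow_mul (by positivity),
    inv_mul_cancel₀ hp0.ne', Real.rpow_one, mul_comm, ← integral_prod_mul]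
  have hVp := (hV _ ENNReal.ofReal_ne_top).integrable_norm_rpow
    (ENNReal.ofReal_pos.2 hp0).ne' ENNReal.ofReal_ne_top
  have hNp := (memLp_id_stdGaussianE (d := d) ENNReal.ofReal_ne_top).integrable_norm_rpow
    (ENNReal.ofReal_pos.2 hp0).ne' ENNReal.ofReal_ne_top
  rw [ENNReal.toReal_ofReal hp0.le] at hVp hNp
  obtain ⟨B, hB⟩ := exists_frobeniusNorm_sub_le hW hF
  have hM : Integrable (fun x => frobeniusNorm
      (1 - Matrix.of fun i j => -cdc (genL W (F i)) (F j) x) ^ p) (gibbsP W) := by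
    refine Integrable.of_bound ((continuous_frobeniusNorm_sub hW hF).rpow_const
      fun x => Or.inr hp0.le).aestronglyMeasurable (B ^ p) (Eventually.of_forall fun x => ?_)
    have h0 : 0 ≤ frobeniusNorm (1 - Matrix.of fun i j => -cdc (genL W (F i)) (F j) x) :=
      Real.sqrt_nonneg _
    rw [Real.norm_of_nonneg (by positivity)]
    gcongr
    exact hB x
  refine integral_mono hVp (hM.mul_prod hNp) fun q => ?_
  have h0 : 0 ≤ frobeniusNorm (1 - Matrix.of fun i j => -cdc (genL W (F i)) (F j) q.1) :=
    Real.sqrt_nonneg _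
  beta_reduce
  rw [← Real.mul_rpow h0 (norm_nonneg _)]
  gcongr
  exact norm_sub_steinKernelApply_le q

end WassersteinBound

/-! ### Stein's method for the total variation distance -/

section SteinTotalVariation

theorem tvDist_le_of_integral_sub_le {μ ν : Measure ℝ} [IsProbabilityMeasure μ]
    [IsProbabilityMeasure ν] {R : ℝ}
    (h : ∀ f : ℝ → ℝ, Continuous f → (∀ t, 0 ≤ f t) → (∀ t, f t ≤ 1) →
      ∫ t, f t ∂μ - ∫ t, f t ∂ν ≤ R) : tvDist μ ν ≤ R := by
  have hR : 0 ≤ R := by simpa using h 0 continuous_zero (by simp) (by simp)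
  have hclosed : ∀ K : Set ℝ, IsClosed K → (μ K).toReal ≤ R + (ν K).toReal := by
    intro K hK
    have hlim : Tendsto (fun k => R + ∫ t, (hK.apprSeq k t : ℝ) ∂ν) atTop
        (𝓝 (R + (ν K).toReal)) := by
      refine tendsto_const_nhds.add ?_
      simp_rw [← BoundedContinuousFunction.toReal_lintegral_coe_eq_integral]
      exact (ENNReal.tendsto_toReal (measure_ne_top ν K)).comp
        (HasOuterApproxClosed.tendsto_lintegral_apprSeq hK ν)
    refine ge_of_tendsto' hlim fun k => ?_
    have hk := h (fun t => (hK.apprSeq k t : ℝ)) (by fun_prop) (fun t => NNReal.coe_nonneg _)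
      fun t => by exact_mod_cast HasOuterApproxClosed.apprSeq_apply_le_one hK k t
    refine le_trans ?_ (sub_le_iff_le_add.1 hk)
    rw [← BoundedContinuousFunction.toReal_lintegral_coe_eq_integral]
    refine ENNReal.toReal_mono ?_ (HasOuterApproxClosed.measure_le_lintegral hK μ k)
    exact (BoundedContinuousFunction.lintegral_lt_top_of_nnreal μ _).ne
  refine Real.sSup_le ?_ hR
  rintro r ⟨B, hB, rfl⟩
  rw [sub_le_iff_le_add]
  refine le_of_forall_pos_le_add fun ε hε => ?_
  obtain ⟨K, hKB, hK, hlt⟩ := hB.exists_isClosed_lt_add (measure_ne_top μ B)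
    (ENNReal.ofReal_pos.2 hε).ne'
  have h1 := ENNReal.toReal_mono (by finiteness) hlt.le
  rw [ENNReal.toReal_add (by finiteness) (by finiteness), ENNReal.toReal_ofReal hε.le] at h1
  have h2 := ENNReal.toReal_mono (by finiteness) (measure_mono (μ := ν) hKB)
  linarith [hclosed K hK]

theorem integrable_id_mul_gaussianPDFReal :
    Integrable fun t => t * gaussianPDFReal 0 1 t := by
  have := integrable_gaussianReal_iff.1
    ((memLp_id_gaussianReal (μ := 0) (v := 1) 1).integrable le_rfl)
  simpa [mul_comm] using this

theorem setIntegral_Ioi_id_mul_gaussianPDFReal (a : ℝ) :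
    ∫ t in Set.Ioi a, t * gaussianPDFReal 0 1 t = gaussianPDFReal 0 1 a := by
  have hd : ∀ t, HasDerivAt (fun t => -gaussianPDFReal 0 1 t) (t * gaussianPDFReal 0 1 t) t :=
    fun t => (hasDerivAt_gaussianPDFReal t).fun_neg.congr_deriv (by ring)
  have hi := integrable_id_mul_gaussianPDFReal
  rw [integral_Ioi_of_hasDerivAt_of_tendsto' (fun t _ => hd t) hi.integrableOn
    (tendsto_zero_of_hasDerivAt_of_integrableOn_Ioi (a := a) (fun t _ => hd t) hi.integrableOn
      (integrable_gaussianPDFReal 0 1).neg.integrableOn)]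
  ring

theorem setIntegral_Iic_id_mul_gaussianPDFReal (a : ℝ) :
    ∫ t in Set.Iic a, t * gaussianPDFReal 0 1 t = -gaussianPDFReal 0 1 a := by
  have hd : ∀ t, HasDerivAt (fun t => -gaussianPDFReal 0 1 t) (t * gaussianPDFReal 0 1 t) t :=
    fun t => (hasDerivAt_gaussianPDFReal t).fun_neg.congr_deriv (by ring)
  have hi := integrable_id_mul_gaussianPDFReal
  rw [integral_Iic_of_hasDerivAt_of_tendsto' (fun t _ => hd t) hi.integrableOn
    (tendsto_zero_of_hasDerivAt_of_integrableOn_Iic (a := a) (fun t _ => hd t) hi.integrableOn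
      (integrable_gaussianPDFReal 0 1).neg.integrableOn)]
  ring

/-- The solution of Stein's equation `f' - t f = g` for the standard Gaussian. -/
def steinSolution (g : ℝ → ℝ) (t : ℝ) : ℝ :=
  (∫ s in Set.Iic t, g s * gaussianPDFReal 0 1 s) / gaussianPDFReal 0 1 t

variable {g : ℝ → ℝ}

theorem continuous_gaussianPDFReal : Continuous (gaussianPDFReal 0 1) :=
  continuous_iff_continuousAt.2 fun t => (hasDerivAt_gaussianPDFReal t).continuousAt

theorem integrable_mul_gaussianPDFReal (hg : Continuous g) {C : ℝ} (hC : ∀ t, |g t| ≤ C) :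
    Integrable fun s => g s * gaussianPDFReal 0 1 s :=
  (integrable_gaussianPDFReal 0 1).bdd_mul hg.aestronglyMeasurable (Eventually.of_forall hC)

theorem hasDerivAt_steinSolution (hg : Continuous g) {C : ℝ} (hC : ∀ t, |g t| ≤ C) (t : ℝ) :
    HasDerivAt (steinSolution g) (g t + t * steinSolution g t) t := by
  have hi := integrable_mul_gaussianPDFReal hg hC
  have hgc : Continuous fun s => g s * gaussianPDFReal 0 1 s :=
    hg.mul continuous_gaussianPDFReal
  have hpos := gaussianPDFReal_pos 0 1 t one_ne_zero
  have h1 : HasDerivAt (fun t => ∫ s in Set.Iic t, g s * gaussianPDFReal 0 1 s)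
      (g t * gaussianPDFReal 0 1 t) t := by
    have h := (hgc.integral_hasStrictDerivAt 0 t).hasDerivAt.add_const
      (∫ s in Set.Iic 0, g s * gaussianPDFReal 0 1 s)
    refine h.congr_of_eventuallyEq (Eventually.of_forall fun u => ?_)
    simp only
    rw [← intervalIntegral.integral_Iic_sub_Iic hi.integrableOn hi.integrableOn, sub_add_cancel]
  refine (h1.fun_div (hasDerivAt_gaussianPDFReal t) hpos.ne').congr_deriv ?_
  rw [steinSolution]
  field_simp
  ring

theorem abs_id_mul_steinSolution_le (hg : Continuous g) (hg1 : ∀ t, |g t| ≤ 1)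
    (h0 : ∫ s, g s * gaussianPDFReal 0 1 s = 0) (t : ℝ) : |t * steinSolution g t| ≤ 1 := by
  have hi := integrable_mul_gaussianPDFReal hg hg1
  have hpos := gaussianPDFReal_pos 0 1 t one_ne_zero
  have hj := integrable_id_mul_gaussianPDFReal
  rw [steinSolution, ← mul_div_assoc, abs_div, abs_of_pos hpos, div_le_one hpos]
  rcases le_total t 0 with ht | ht
  · rw [← neg_neg (gaussianPDFReal 0 1 t), ← setIntegral_Iic_id_mul_gaussianPDFReal,
      ← integral_const_mul, ← integral_neg, ← Real.norm_eq_abs]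
    refine norm_integral_le_of_norm_le hj.neg.integrableOn
      ((ae_restrict_iff' measurableSet_Iic).2 (Eventually.of_forall fun s hs => ?_))
    have hs : s ≤ t := hs
    have := gaussianPDFReal_nonneg 0 1 s
    rw [Real.norm_eq_abs, abs_mul, abs_mul, abs_of_nonneg this, abs_of_nonpos ht]
    calc -t * (|g s| * gaussianPDFReal 0 1 s) ≤ -s * (1 * gaussianPDFReal 0 1 s) := by
          gcongr
          · linarith
          · exact hg1 s
      _ = -(s * gaussianPDFReal 0 1 s) := by ring
  · have hsplit := intervalIntegral.integral_Iic_add_Ioi (b := t) hi.integrableOn hi.integrableOn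
    rw [h0, ← eq_neg_iff_add_eq_zero] at hsplit
    rw [hsplit, mul_neg, abs_neg, ← setIntegral_Ioi_id_mul_gaussianPDFReal,
      ← integral_const_mul, ← Real.norm_eq_abs]
    refine norm_integral_le_of_norm_le hj.integrableOn
      ((ae_restrict_iff' measurableSet_Ioi).2 (Eventually.of_forall fun s hs => ?_))
    have hs : t < s := hs
    have := gaussianPDFReal_nonneg 0 1 s
    rw [Real.norm_eq_abs, abs_mul, abs_mul, abs_of_nonneg this, abs_of_nonneg ht]
    calc t * (|g s| * gaussianPDFReal 0 1 s) ≤ s * (1 * gaussianPDFReal 0 1 s) := by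
          gcongr
          · exact ht.trans hs.le
          · exact hg1 s
      _ = s * gaussianPDFReal 0 1 s := by ring

variable {n : ℕ} {W G : (Fin n → ℝ) → ℝ}

theorem cdc_comp_genL (hW : ContDiff ℝ 2 W) (hG : IsCcInfty G) {f f' : ℝ → ℝ}
    (hf : ∀ t, HasDerivAt f (f' t) t) (x : Fin n → ℝ) :
    cdc G (fun x => f (genL W G x)) x = f' (genL W G x) * cdc (genL W G) G x := by
  have hX := (hG.contDiff_genL hW).differentiable one_ne_zero x
  have h : HasFDerivAt (fun x => f (genL W G x)) (f' (genL W G x) • fderiv ℝ (genL W G) x) x :=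
    (hf _).comp_hasFDerivAt x hX.hasFDerivAt
  simp only [cdc, Finset.mul_sum]
  refine Finset.sum_congr rfl fun i _ => ?_
  rw [pd_eq_fderiv h.differentiableAt, h.fderiv, pd_eq_fderiv hX, smul_apply, smul_eq_mul]
  ring

theorem tvDist_genL_le (hW : ContDiff ℝ 2 W)
    (hZ : Integrable fun x : Fin n → ℝ => Real.exp (-W x)) (hG : IsCcInfty G) :
    tvDist ((gibbsP W).map (genL W G)) (gaussianReal 0 1) ≤
      2 * ∫ x, |1 - (-cdc (genL W G) G x)| ∂gibbsP W := by
  have := isProbabilityMeasure_gibbsP hZ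
  have hXd := hG.contDiff_genL hW
  have hXc := hXd.continuous
  have := Measure.isProbabilityMeasure_map (μ := gibbsP W) hXc.aemeasurable
  refine tvDist_le_of_integral_sub_le fun h hh h0 h1 => ?_
  set m := ∫ t, h t ∂gaussianReal 0 1 with hm
  have hhi : Integrable h (gaussianReal 0 1) := Integrable.of_bound hh.aestronglyMeasurable 1
    (Eventually.of_forall fun t => by rw [Real.norm_eq_abs, abs_of_nonneg (h0 t)]; exact h1 t)
  have hm0 : 0 ≤ m := integral_nonneg h0
  have hm1 : m ≤ 1 := by
    simpa using integral_mono hhi (integrable_const 1) h1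
  set g : ℝ → ℝ := fun t => h t - m with hgdef
  have hg : Continuous g := hh.sub continuous_const
  have hg1 : ∀ t, |g t| ≤ 1 := fun t =>
    abs_sub_le_iff.2 ⟨by linarith [h1 t], by linarith [h0 t]⟩
  have hg0 : ∫ s, g s * gaussianPDFReal 0 1 s = 0 := by
    have : ∫ s, g s ∂gaussianReal 0 1 = 0 := by
      rw [integral_sub hhi (integrable_const m)]
      simp [hm]
    rw [integral_gaussianReal_eq_integral_smul one_ne_zero] at this
    simpa [mul_comm] using this
  set f := steinSolution g
  set f' : ℝ → ℝ := fun t => g t + t * f t with hf'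
  have hf : ∀ t, HasDerivAt f (f' t) t := hasDerivAt_steinSolution hg hg1
  have hfc : Continuous f := continuous_iff_continuousAt.2 fun t => (hf t).continuousAt
  have hf'c : Continuous f' := hg.add (continuous_id.mul hfc)
  have htf := abs_id_mul_steinSolution_le hg hg1 hg0
  have hf'2 : ∀ t, |f' t| ≤ 2 := fun t =>
    (abs_add_le _ _).trans (by linarith [hg1 t, htf t])
  have hfd : ContDiff ℝ 1 f := contDiff_one_iff_deriv.2
    ⟨fun t => (hf t).differentiableAt, by rwa [funext fun t => (hf t).deriv]⟩
  have ibp := integral_genL_mul hW hZ hG (u := fun x => f (genL W G x)) (hfd.comp hXd)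
  have hcdc : Continuous (cdc (genL W G) G) := continuous_cdc hXd hG.contDiff_one
  have hcs : HasCompactSupport (cdc (genL W G) G) :=
    hasCompactSupport_cdc hXd (hG.hasCompactSupport_genL W) G
  have iK : Integrable (fun x => 1 - (-cdc (genL W G) G x)) (gibbsP W) := by
    obtain ⟨B, hB⟩ := hcs.exists_bound_of_continuous hcdc
    exact (integrable_const 1).sub (Integrable.of_bound hcdc.aestronglyMeasurable B
      (Eventually.of_forall hB)).neg
  have if' : Integrable (fun x => f' (genL W G x)) (gibbsP W) :=
    Integrable.of_bound (hf'c.comp hXc).aestronglyMeasurable 2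
      (Eventually.of_forall fun x => hf'2 _)
  have ixf : Integrable (fun x => genL W G x * f (genL W G x)) (gibbsP W) :=
    Integrable.of_bound (hXc.mul (hfc.comp hXc)).aestronglyMeasurable 1
      (Eventually.of_forall fun x => htf _)
  have iK' : Integrable (fun x => f' (genL W G x) * (1 - (-cdc (genL W G) G x))) (gibbsP W) :=
    iK.bdd_mul (hf'c.comp hXc).aestronglyMeasurable (Eventually.of_forall fun x => hf'2 _)
  calc ∫ t, h t ∂(gibbsP W).map (genL W G) - m
      = ∫ x, (f' (genL W G x) - genL W G x * f (genL W G x)) ∂gibbsP W := by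
        rw [integral_map hXc.aemeasurable hh.aestronglyMeasurable]
        have ih : Integrable (fun x => h (genL W G x)) (gibbsP W) :=
          Integrable.of_bound (hh.comp hXc).aestronglyMeasurable 1
            (Eventually.of_forall fun x => by
              rw [Real.norm_eq_abs, abs_of_nonneg (h0 _)]; exact h1 _)
        simp only [hf', hgdef, add_sub_cancel_right]
        rw [integral_sub ih (integrable_const m)]
        simp
    _ = ∫ x, f' (genL W G x) * (1 - (-cdc (genL W G) G x)) ∂gibbsP W := by
        rw [integral_sub if' ixf, ibp, sub_neg_eq_add]
        have hc : (fun x => cdc G (fun x => f (genL W G x)) x) =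
            fun x => f' (genL W G x) * (1 - (-cdc (genL W G) G x)) - f' (genL W G x) := by
          ext x
          rw [cdc_comp_genL hW hG hf]
          ring
        rw [hc, integral_sub iK' if']
        ring
    _ ≤ ∫ x, 2 * |1 - (-cdc (genL W G) G x)| ∂gibbsP W := by
        refine integral_mono iK' (iK.abs.const_mul 2) fun x => ?_
        refine (le_abs_self _).trans ?_
        rw [abs_mul]
        gcongr
        exact hf'2 _
    _ = 2 * ∫ x, |1 - (-cdc (genL W G) G x)| ∂gibbsP W := integral_const_mul _ _

end SteinTotalVariation

/-- Γ-Stein bounds for `X = (L F₁, …, L F_d)` under a Gibbs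
measure: a `p`-Wasserstein bound in any dimension and a total variation bound in
dimension one. -/
theorem statement9 (n : ℕ) (W : (Fin n → ℝ) → ℝ) (hW : ContDiff ℝ 2 W)
    (hZ0 : Integrable (fun x : Fin n → ℝ => Real.exp (-W x)))
    (d : ℕ) (F : Fin d → (Fin n → ℝ) → ℝ) (hF : ∀ i, IsCcInfty (F i)) :
    (∀ p : ℝ, 1 ≤ p →
      wassersteinDist p
          ((gibbsP W).map (fun x => (WithLp.equiv 2 (∀ _ : Fin d, ℝ)).symm
            fun i => genL W (F i) x))
          (stdGaussianE d) ^ p ≤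
        (∫ y, ‖y‖ ^ p ∂stdGaussianE d) *
          ∫ x, frobeniusNorm
            (1 - Matrix.of fun i j => -cdc (genL W (F i)) (F j) x) ^ p ∂gibbsP W) ∧
    (∀ G : (Fin n → ℝ) → ℝ, IsCcInfty G →
      tvDist ((gibbsP W).map (genL W G)) (gaussianReal 0 1) ≤
        2 * ∫ x, |1 - (-cdc (genL W G) G x)| ∂gibbsP W) := by
  refine ⟨fun p hp => ?_, fun G hG => tvDist_genL_le hW hZ0 hG⟩
  exact wassersteinDist_genLVec_rpow_le hW hZ0 hF hp
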